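/- arXiv:2107.12723 — 5 statements merged into one kernel-verified Lean document; each statement's English description precedes it below -/
import Mathlib

section
/- (Generalisation gap via on-average parameter stability) For any t ≥ 0, the expected generalisation gap of the t-th gradient-descent iterate satisfies E[L(W_t) − L_S(W_t)] ≤ √2 B_{φ'} C_x √(E[L_S(W_t)]) · √((1/n) Σ_{i=1}^n E[‖W_t − W_t^{(i)}‖_F²]) + (1/2) B_{φ'}² C_x² · (1/n) Σ_{i=1}^n E[‖W_t − W_t^{(i)}‖_F²], where expectations are over the sample S and the independent copies z̃_i. -/
open MeasureTheory Finset
open scoped BigOperators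

noncomputable section

/-- The parameter space of a width-`m` shallow network on `ℝ^d`, with the
Euclidean (= Frobenius, after vectorisation) norm. -/
abbrev Param (d m : ℕ) : Type := EuclideanSpace ℝ (Fin m × Fin d)

/-- Inputs live in `ℝ^d` with the Euclidean norm. -/
abbrev Input (d : ℕ) : Type := EuclideanSpace ℝ (Fin d)

/-- Shallow network `f_W(x) = ∑ₖ uₖ φ(⟨Wₖ, x⟩)`. -/
def nnet {d m : ℕ} (φ : ℝ → ℝ) (u : Fin m → ℝ) (W : Param d m) (x : Input d) : ℝ :=
  ∑ k : Fin m, u k * φ (∑ j : Fin d, W (k, j) * x j)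

/-- Squared loss `ℓ(W, (x, y)) = (f_W(x) − y)² / 2`. -/
def sqLoss {d m : ℕ} (φ : ℝ → ℝ) (u : Fin m → ℝ) (W : Param d m) (z : Input d × ℝ) : ℝ :=
  (nnet φ u W z.1 - z.2) ^ 2 / 2

/-- Empirical risk `L_S(W) = (1/n) ∑ᵢ ℓ(W, zᵢ)`. -/
def empRisk {d m n : ℕ} (φ : ℝ → ℝ) (u : Fin m → ℝ) (S : Fin n → Input d × ℝ)
    (W : Param d m) : ℝ :=
  (∑ i : Fin n, sqLoss φ u W (S i)) / n

/-- Gradient-descent iterates `W_{t+1} = W_t − η ∇L(W_t)` started at `W0`. -/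
def gdIter {d m : ℕ} (η : ℝ) (L : Param d m → ℝ) (W0 : Param d m) : ℕ → Param d m
  | 0 => W0
  | t + 1 => gdIter η L W0 t - η • gradient L (gdIter η L W0 t)

end

section aux

variable {d m n : ℕ} {φ : ℝ → ℝ} {u : Fin m → ℝ}

/-- explicit gradient of the network -/
noncomputable def gradNet (φ : ℝ → ℝ) (u : Fin m → ℝ) (W : Param d m) (x : Input d) : Param d m :=
  ∑ k : Fin m, (u k * deriv φ (∑ j : Fin d, W (k, j) * x j)) •
    ∑ j : Fin d, x j • EuclideanSpace.single (k, j) (1 : ℝ)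

/-- explicit gradient of the risk -/
noncomputable def gradRisk (φ : ℝ → ℝ) (u : Fin m → ℝ) (S : Fin n → Input d × ℝ) (W : Param d m) :
    Param d m :=
  (n : ℝ)⁻¹ • ∑ i : Fin n, (nnet φ u W (S i).1 - (S i).2) • gradNet φ u W (S i).1

lemma hasGrad_net (hφ : Differentiable ℝ φ) (W : Param d m) (x : Input d) :
    HasFDerivAt (fun W => nnet φ u W x) (InnerProductSpace.toDual ℝ _ (gradNet φ u W x)) W := by
  have hlin : ∀ k : Fin m, HasFDerivAt (fun W : Param d m => ∑ j : Fin d, W (k, j) * x j)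
      (InnerProductSpace.toDual ℝ _ (∑ j : Fin d, x j • EuclideanSpace.single (k, j) (1 : ℝ))) W := by
    intro k
    have h := (InnerProductSpace.toDual ℝ (Param d m) (∑ j : Fin d, x j • EuclideanSpace.single (k, j) (1 : ℝ))).hasFDerivAt (x := W)
    refine h.congr_of_eventuallyEq (Filter.Eventually.of_forall fun V => ?_)
    simp [EuclideanSpace.inner_single_left, mul_comm]
  have h2 : HasFDerivAt (fun W : Param d m => nnet φ u W x)
      (∑ k : Fin m, u k • (deriv φ (∑ j : Fin d, W (k, j) * x j) •
      (InnerProductSpace.toDual ℝ _ (∑ j : Fin d, x j • EuclideanSpace.single (k, j) (1 : ℝ))))) W := by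
    unfold nnet
    refine HasFDerivAt.fun_sum fun k _ => ?_
    have := (hφ (∑ j : Fin d, W (k, j) * x j)).hasDerivAt.comp_hasFDerivAt W (hlin k)
    exact this.const_mul (u k)
  convert h2 using 1
  unfold gradNet
  rw [map_sum]
  refine Finset.sum_congr rfl fun k _ => ?_
  rw [map_smulₛₗ, smul_smul]
  simp

lemma hasGrad_risk (hφ : Differentiable ℝ φ) (S : Fin n → Input d × ℝ) (W : Param d m) :
    gradient (empRisk φ u S) W = gradRisk φ u S W := by
  apply HasGradientAt.gradient
  rw [hasGradientAt_iff_hasFDerivAt]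
  have h1 : ∀ i : Fin n, HasFDerivAt (fun W => sqLoss φ u W (S i))
      ((nnet φ u W (S i).1 - (S i).2) • (InnerProductSpace.toDual ℝ _ (gradNet φ u W (S i).1))) W := by
    intro i
    have h := (hasGrad_net (u := u) hφ W (S i).1).sub_const (S i).2
    have hd : HasDerivAt (fun r : ℝ => r ^ 2 / 2) (nnet φ u W (S i).1 - (S i).2)
        (nnet φ u W (S i).1 - (S i).2) := by
      have := ((hasDerivAt_id (nnet φ u W (S i).1 - (S i).2)).pow 2).div_const 2
      refine this.congr_deriv ?_
      simp
    exact hd.comp_hasFDerivAt W h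
  have h2 := (HasFDerivAt.fun_sum (u := Finset.univ) fun i _ => h1 i).const_mul ((n : ℝ)⁻¹)
  have h3 : empRisk φ u S = fun W => (n : ℝ)⁻¹ * ∑ i : Fin n, sqLoss φ u W (S i) := by
    funext V
    unfold empRisk
    rw [div_eq_inv_mul]
  rw [h3]
  refine h2.congr_fderiv ?_
  unfold gradRisk
  rw [map_smulₛₗ, map_sum]
  simp

lemma cont_net (hφ : Differentiable ℝ φ) :
    Continuous (fun q : Param d m × Input d => nnet φ u q.1 q.2) := by
  have := hφ.continuous
  unfold nnet
  fun_prop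

lemma meas_gradNet :
    Measurable (fun q : Param d m × Input d => gradNet φ u q.1 q.2) := by
  unfold gradNet
  refine Finset.measurable_sum _ fun k _ => ?_
  have h1 : Continuous (fun q : Param d m × Input d => ∑ j : Fin d, q.1 (k, j) * q.2 j) := by
    fun_prop
  have h2 : Continuous (fun q : Param d m × Input d =>
    ∑ j : Fin d, q.2 j • (EuclideanSpace.single (k, j) (1 : ℝ) : Param d m)) := by
    fun_prop
  exact (((measurable_deriv φ).comp h1.measurable).const_mul (u k)).smul h2.measurable

lemma meas_gradRisk (hφ : Differentiable ℝ φ) :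
    Measurable (fun q : (Fin n → Input d × ℝ) × Param d m => gradRisk φ u q.1 q.2) := by
  unfold gradRisk
  suffices h : Measurable (fun q : (Fin n → Input d × ℝ) × Param d m => ∑ i : Fin n,
      (nnet φ u q.2 (q.1 i).1 - (q.1 i).2) • gradNet φ u q.2 (q.1 i).1) from
    h.const_smul ((n : ℝ)⁻¹)
  refine Finset.measurable_sum _ fun i _ => ?_
  have h1 : Measurable (fun q : (Fin n → Input d × ℝ) × Param d m => (q.2, (q.1 i).1)) := by
    fun_prop
  have h2 := (cont_net (u := u) hφ).measurable.comp h1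
  have h3 := (meas_gradNet (φ := φ) (u := u)).comp h1
  exact (h2.sub (by fun_prop)).smul h3

lemma meas_iter (hφ : Differentiable ℝ φ) (η : ℝ) (W0 : Param d m) (t : ℕ) :
    Measurable (fun S : Fin n → Input d × ℝ => gdIter η (empRisk φ u S) W0 t) := by
  induction t with
  | zero => exact measurable_const
  | succ t ih =>
    simp only [gdIter, hasGrad_risk hφ]
    exact ih.sub (((meas_gradRisk hφ).comp (measurable_id.prodMk ih)).const_smul η)

lemma meas_loss (hφ : Differentiable ℝ φ) :
    Measurable (fun q : Param d m × (Input d × ℝ) => sqLoss φ u q.1 q.2) := by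
  unfold sqLoss
  have h1 : Measurable (fun q : Param d m × (Input d × ℝ) => (q.1, q.2.1)) := by fun_prop
  have h2 := (cont_net (u := u) hφ).measurable.comp h1
  exact ((h2.sub (by fun_prop)).pow_const 2).div_const 2

lemma phi_lip (hφ : Differentiable ℝ φ) {B : ℝ} (hB : ∀ s, |deriv φ s| ≤ B) (a b : ℝ) :
    |φ a - φ b| ≤ B * |a - b| := by
  have := Convex.norm_image_sub_le_of_norm_deriv_le (𝕜 := ℝ) (f := φ) (s := Set.univ) (C := B)
    (fun x _ => hφ x) (fun x _ => hB x) convex_univ (Set.mem_univ b) (Set.mem_univ a)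
  simpa using this

lemma u_sq (hu : ∀ k, u k = 1 / Real.sqrt m ∨ u k = -(1 / Real.sqrt m)) (k : Fin m) :
    u k ^ 2 = 1 / m := by
  rcases hu k with h | h <;> rw [h] <;> simp

lemma net_lip (hφ : Differentiable ℝ φ) {B : ℝ} (hB : ∀ s, |deriv φ s| ≤ B)
    (hu : ∀ k, u k = 1 / Real.sqrt m ∨ u k = -(1 / Real.sqrt m)) (W V : Param d m) (x : Input d) :
    |nnet φ u W x - nnet φ u V x| ≤ B * ‖x‖ * ‖W - V‖ := by
  have hB0 : 0 ≤ B := (abs_nonneg _).trans (hB 0)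
  apply abs_le_of_sq_le_sq _ (by positivity)
  have e : nnet φ u W x - nnet φ u V x = ∑ k : Fin m, u k *
      (φ (∑ j : Fin d, W (k, j) * x j) - φ (∑ j : Fin d, V (k, j) * x j)) := by
    simp [nnet, mul_sub]
  rw [e]
  refine (Finset.sum_mul_sq_le_sq_mul_sq _ _ _).trans ?_
  have h1 : ∑ k : Fin m, u k ^ 2 ≤ 1 := by
    simp only [u_sq hu]
    simp
    exact mul_inv_le_one
  have h2 : ∀ k : Fin m, (φ (∑ j : Fin d, W (k, j) * x j) - φ (∑ j : Fin d, V (k, j) * x j)) ^ 2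
      ≤ B ^ 2 * (‖x‖ ^ 2 * ∑ j : Fin d, (W - V) (k, j) ^ 2) := by
    intro k
    have h := phi_lip hφ hB (∑ j : Fin d, W (k, j) * x j) (∑ j : Fin d, V (k, j) * x j)
    have h3 : (∑ j : Fin d, W (k, j) * x j) - (∑ j : Fin d, V (k, j) * x j)
       = ∑ j : Fin d, (W - V) (k, j) * x j := by
      simp [sub_mul]
    rw [h3] at h
    have h4 := Finset.sum_mul_sq_le_sq_mul_sq Finset.univ (fun j => (W - V) (k, j)) (fun j => x j)
    have h5 : ‖x‖ ^ 2 = ∑ j, x j ^ 2 := by simp [EuclideanSpace.norm_sq_eq]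
    calc _ = |φ (∑ j : Fin d, W (k, j) * x j) - φ (∑ j : Fin d, V (k, j) * x j)| ^ 2 := (sq_abs _).symm
      _ ≤ (B * |∑ j : Fin d, (W - V) (k, j) * x j|) ^ 2 := by gcongr
      _ = B ^ 2 * (∑ j : Fin d, (W - V) (k, j) * x j) ^ 2 := by rw [mul_pow, sq_abs]
      _ ≤ _ := by
        gcongr
        rw [h5, mul_comm]
        exact h4
  have h6 : ‖W - V‖ ^ 2 = ∑ k : Fin m, ∑ j : Fin d, (W - V) (k, j) ^ 2 := by
    rw [EuclideanSpace.norm_sq_eq, Fintype.sum_prod_type]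
    simp
  calc _ ≤ 1 * ∑ k : Fin m, B ^ 2 * (‖x‖ ^ 2 * ∑ j : Fin d, (W - V) (k, j) ^ 2) := by
        gcongr with k
        exact h2 k
    _ = _ := by
      rw [← Finset.mul_sum, ← Finset.mul_sum, ← h6]
      ring

/-- good points -/
def Good (Cx Cy : ℝ) (z : Input d × ℝ) : Prop := ‖z.1‖ ≤ Cx ∧ |z.2| ≤ Cy

lemma net_bdd (hφ : Differentiable ℝ φ) {B : ℝ} (hB : ∀ s, |deriv φ s| ≤ B)
    (hu : ∀ k, u k = 1 / Real.sqrt m ∨ u k = -(1 / Real.sqrt m)) {Cx Cy R : ℝ} (W : Param d m)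
    (z : Input d × ℝ) (hz : Good Cx Cy z) (hW : ‖W‖ ≤ R) :
    |nnet φ u W z.1 - z.2| ≤ B * Cx * R + |∑ k : Fin m, u k * φ 0| + Cy := by
  have hB0 : 0 ≤ B := (abs_nonneg _).trans (hB 0)
  have hCx : 0 ≤ Cx := (norm_nonneg _).trans hz.1
  have h := net_lip hφ hB hu W 0 z.1
  have h0 : nnet φ u (0 : Param d m) z.1 = ∑ k : Fin m, u k * φ 0 := by simp [nnet]
  rw [h0, sub_zero] at h
  have h1 : B * ‖z.1‖ * ‖W‖ ≤ B * Cx * R := by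
    gcongr
    exact hz.1
  have h2 := hz.2
  rw [show nnet φ u W z.1 - z.2 = (nnet φ u W z.1 - ∑ k : Fin m, u k * φ 0)
    + (∑ k : Fin m, u k * φ 0) + (- z.2) by ring]
  refine (abs_add_three _ _ _).trans ?_
  rw [abs_neg]
  linarith

lemma gradNet_bdd {B : ℝ} (hB : ∀ s, |deriv φ s| ≤ B) {Cx : ℝ} (W : Param d m) (x : Input d)
    (hx : ‖x‖ ≤ Cx) : ‖gradNet φ u W x‖ ≤ ∑ k : Fin m, (|u k| * B) * ∑ _j : Fin d, Cx := by
  have hB0 : 0 ≤ B := (abs_nonneg _).trans (hB 0)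
  unfold gradNet
  refine (norm_sum_le _ _).trans (Finset.sum_le_sum fun k _ => ?_)
  rw [norm_smul, norm_mul]
  gcongr
  · simp
  · exact hB _
  · refine (norm_sum_le _ _).trans (Finset.sum_le_sum fun j _ => ?_)
    rw [norm_smul]
    simp only [PiLp.norm_single, norm_one, mul_one]
    exact (PiLp.norm_apply_le x j).trans hx

lemma iter_bdd (hφ : Differentiable ℝ φ) {B : ℝ} (hB : ∀ s, |deriv φ s| ≤ B)
    (hu : ∀ k, u k = 1 / Real.sqrt m ∨ u k = -(1 / Real.sqrt m)) (Cx Cy : ℝ)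
    (η : ℝ) (W0 : Param d m) (t : ℕ) :
    ∃ R : ℝ, ∀ S : Fin n → Input d × ℝ, (∀ i, Good Cx Cy (S i)) →
      ‖gdIter η (empRisk φ u S) W0 t‖ ≤ R := by
  induction t with
  | zero => exact ⟨‖W0‖, fun S _ => le_rfl⟩
  | succ t ih =>
    obtain ⟨R, hR⟩ := ih
    refine ⟨R + ‖η‖ * (‖(n : ℝ)⁻¹‖ * ∑ _i : Fin n, (B * Cx * R + |∑ k : Fin m, u k * φ 0| + Cy)
      * ∑ k : Fin m, (|u k| * B) * ∑ _j : Fin d, Cx), fun S hS => ?_⟩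
    simp only [gdIter, hasGrad_risk hφ]
    refine (norm_sub_le _ _).trans (add_le_add (hR S hS) ?_)
    rw [norm_smul]
    unfold gradRisk
    rw [norm_smul]
    gcongr
    refine (norm_sum_le _ _).trans (Finset.sum_le_sum fun i _ => ?_)
    rw [norm_smul]
    have h1 := net_bdd hφ hB hu _ (S i) (hS i) (hR S hS)
    refine mul_le_mul h1 (gradNet_bdd hB _ _ (hS i).1) (norm_nonneg _) ((abs_nonneg _).trans h1)

/-- exchange coordinate i -/
def swapAt {α : Type*} (i : Fin n) (p : (Fin n → α) × (Fin n → α)) : (Fin n → α) × (Fin n → α) :=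
  (Function.update p.1 i (p.2 i), Function.update p.2 i (p.1 i))

lemma mp_swapAt {α : Type*} [MeasurableSpace α] (μ : Measure α) [IsProbabilityMeasure μ] (i : Fin n) :
    MeasurePreserving (swapAt i)
      ((Measure.pi fun _ : Fin n => μ).prod (Measure.pi fun _ : Fin n => μ))
      ((Measure.pi fun _ : Fin n => μ).prod (Measure.pi fun _ : Fin n => μ)) := by
  have e := measurePreserving_arrowProdEquivProdArrow α α (Fin n) (fun _ => μ) (fun _ => μ)
  have hp : MeasurePreserving (fun (q : Fin n → α × α) j => (if j = i then Prod.swap else id) (q j))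
      (Measure.pi fun _ : Fin n => μ.prod μ) (Measure.pi fun _ : Fin n => μ.prod μ) := by
    refine measurePreserving_pi _ _ fun j => ?_
    split_ifs
    · exact Measure.measurePreserving_swap
    · exact MeasurePreserving.id _
  have := (e.comp hp).comp (e.symm _)
  convert this using 1
  funext p
  refine Prod.ext ?_ ?_ <;> funext j <;> by_cases h : j = i <;>
    simp [swapAt, h, MeasurableEquiv.arrowProdEquivProdArrow, Equiv.arrowProdEquivProdArrow]

lemma key_real {X A D K : ℝ} (hA : 0 ≤ A) (hD : 0 ≤ D) (hK : 0 ≤ K)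
    (h : ∀ c > 0, X ≤ K * (c / 2 * A + D / (2 * c))) : X ≤ K * Real.sqrt A * Real.sqrt D := by
  set a := Real.sqrt A
  set b := Real.sqrt D
  have ha : 0 ≤ a := Real.sqrt_nonneg _
  have hb : 0 ≤ b := Real.sqrt_nonneg _
  have hAa : A = a ^ 2 := (Real.sq_sqrt hA).symm
  have hDb : D = b ^ 2 := (Real.sq_sqrt hD).symm
  have hlim : ∀ ε > 0, X ≤ K * (a * b + ε * ((a + b) / 2)) := by
    intro ε hε
    refine (h ((b + ε) / (a + ε)) (by positivity)).trans (mul_le_mul_of_nonneg_left ?_ hK)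
    have h1 : (b + ε) / (a + ε) / 2 * A ≤ (b + ε) * a / 2 := by
      rw [hAa, div_div, div_mul_eq_mul_div, div_le_iff₀ (by positivity)]
      nlinarith [mul_nonneg (mul_nonneg ha (add_nonneg hb hε.le)) hε.le]
    have h2 : D / (2 * ((b + ε) / (a + ε))) ≤ (a + ε) * b / 2 := by
      rw [hDb, div_le_iff₀ (by positivity)]
      have : (a + ε) * b / 2 * (2 * ((b + ε) / (a + ε))) = b * (b + ε) := by
        field_simp
      rw [this]
      nlinarith [mul_nonneg hb hε.le]
    linarith
  have : X ≤ K * (a * b + 0 * ((a + b) / 2)) := by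
    refine ge_of_tendsto (x := nhdsWithin (0:ℝ) (Set.Ioi 0))
      (f := fun ε : ℝ => K * (a * b + ε * ((a + b) / 2))) ?_ ?_
    · refine Filter.Tendsto.mono_left (Continuous.tendsto (by fun_prop) 0) nhdsWithin_le_nhds
    · filter_upwards [self_mem_nhdsWithin] with ε hε using hlim ε hε
  calc X ≤ _ := this
    _ = _ := by ring

lemma loss_diff (hφ : Differentiable ℝ φ) {B : ℝ} (hB : ∀ s, |deriv φ s| ≤ B)
    (hu : ∀ k, u k = 1 / Real.sqrt m ∨ u k = -(1 / Real.sqrt m)) {Cx Cy : ℝ} (W V : Param d m)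
    (z : Input d × ℝ) (hz : Good Cx Cy z) {c : ℝ} (hc : 0 < c) :
    sqLoss φ u V z - sqLoss φ u W z ≤ (Real.sqrt 2 * B * Cx) * (c / 2 * sqLoss φ u W z
      + ‖W - V‖ ^ 2 / (2 * c)) + (1 / 2) * B ^ 2 * Cx ^ 2 * ‖W - V‖ ^ 2 := by
  have hB0 : 0 ≤ B := (abs_nonneg _).trans (hB 0)
  have hCx : 0 ≤ Cx := (norm_nonneg _).trans hz.1
  have h := net_lip hφ hB hu V W z.1
  rw [norm_sub_rev] at h
  have h' : |nnet φ u V z.1 - nnet φ u W z.1| ≤ B * Cx * ‖W - V‖ := by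
    refine h.trans ?_
    gcongr
    exact hz.1
  unfold sqLoss
  generalize nnet φ u V z.1 = v at *
  generalize nnet φ u W z.1 = w at *
  generalize ‖W - V‖ = D at *
  have e : (v - z.2) ^ 2 / 2 - (w - z.2) ^ 2 / 2 = (v - w) * (w - z.2) + (v - w) ^ 2 / 2 := by ring
  rw [e]
  have h1 : (v - w) ^ 2 / 2 ≤ (1 / 2) * B ^ 2 * Cx ^ 2 * D ^ 2 := by
    have : |v - w| ^ 2 ≤ (B * Cx * D) ^ 2 := by gcongr
    rw [sq_abs] at this
    nlinarith
  have h2 : (v - w) * (w - z.2) ≤ (Real.sqrt 2 * B * Cx) * (c / 2 * ((w - z.2) ^ 2 / 2)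
      + D ^ 2 / (2 * c)) := by
    have h3 : (v - w) * (w - z.2) ≤ B * Cx * (D * |w - z.2|) := by
      calc _ ≤ |(v - w) * (w - z.2)| := le_abs_self _
        _ = |v - w| * |w - z.2| := abs_mul _ _
        _ ≤ (B * Cx * D) * |w - z.2| := by gcongr
        _ = _ := by ring
    refine h3.trans ?_
    rw [show Real.sqrt 2 * B * Cx * (c / 2 * ((w - z.2) ^ 2 / 2) + D ^ 2 / (2 * c))
      = B * Cx * (Real.sqrt 2 * (c / 2 * ((w - z.2) ^ 2 / 2) + D ^ 2 / (2 * c))) by ring]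
    refine mul_le_mul_of_nonneg_left ?_ (mul_nonneg hB0 hCx)
    rw [← sq_abs (w - z.2)]
    generalize |w - z.2| = y
    have hs : Real.sqrt 2 ^ 2 = 2 := Real.sq_sqrt (by norm_num)
    have hs0 : 0 < Real.sqrt 2 := by positivity
    have : Real.sqrt 2 * (c / 2 * (y ^ 2 / 2) + D ^ 2 / (2 * c)) - D * y
      = Real.sqrt 2 / (4 * c) * (c * y - Real.sqrt 2 * D) ^ 2 := by
      field_simp
      ring_nf
      simp only [show Real.sqrt 2 ^ 3 = Real.sqrt 2 * 2 by rw [pow_succ, hs]; ring, hs]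
      ring
    have h5 : 0 ≤ Real.sqrt 2 / (4 * c) * (c * y - Real.sqrt 2 * D) ^ 2 := by positivity
    linarith
  linarith

end aux

/-- generalisation gap via on-average parameter stability (Lemma 3 of the paper).
The expectation is over the pair `p = (S, S̃)` of the sample and its independent copy,
drawn from the product measure; `S^{(i)} = Function.update p.1 i (p.2 i)`. -/
theorem statement4 {d m n : ℕ} (hn : 1 ≤ n)
    (φ : ℝ → ℝ) (Bφ' : ℝ)
    (hφ : Differentiable ℝ φ) (hBφ' : ∀ s : ℝ, |deriv φ s| ≤ Bφ')
    (u : Fin m → ℝ) (hu : ∀ k, u k = 1 / Real.sqrt m ∨ u k = -(1 / Real.sqrt m))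
    (Cx Cy : ℝ) (hCx : 0 < Cx) (hCy : 0 < Cy)
    (μ : Measure (Input d × ℝ)) [IsProbabilityMeasure μ]
    (hsupp : ∀ᵐ z ∂μ, ‖z.1‖ ≤ Cx ∧ |z.2| ≤ Cy)
    (W0 : Param d m) (η : ℝ) (hη0 : 0 < η) (t : ℕ) :
    (∫ p : (Fin n → Input d × ℝ) × (Fin n → Input d × ℝ),
        ((∫ z, sqLoss φ u (gdIter η (empRisk φ u p.1) W0 t) z ∂μ)
          - empRisk φ u p.1 (gdIter η (empRisk φ u p.1) W0 t))
        ∂((Measure.pi fun _ : Fin n => μ).prod (Measure.pi fun _ : Fin n => μ)))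
      ≤ Real.sqrt 2 * Bφ' * Cx
          * Real.sqrt (∫ p : (Fin n → Input d × ℝ) × (Fin n → Input d × ℝ),
              empRisk φ u p.1 (gdIter η (empRisk φ u p.1) W0 t)
              ∂((Measure.pi fun _ : Fin n => μ).prod (Measure.pi fun _ : Fin n => μ)))
          * Real.sqrt ((1 / (n : ℝ)) * ∑ i : Fin n,
              ∫ p : (Fin n → Input d × ℝ) × (Fin n → Input d × ℝ),
                ‖gdIter η (empRisk φ u p.1) W0 t
                  - gdIter η (empRisk φ u (Function.update p.1 i (p.2 i))) W0 t‖ ^ 2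
                ∂((Measure.pi fun _ : Fin n => μ).prod (Measure.pi fun _ : Fin n => μ)))
        + (1 / 2) * Bφ' ^ 2 * Cx ^ 2
          * ((1 / (n : ℝ)) * ∑ i : Fin n,
              ∫ p : (Fin n → Input d × ℝ) × (Fin n → Input d × ℝ),
                ‖gdIter η (empRisk φ u p.1) W0 t
                  - gdIter η (empRisk φ u (Function.update p.1 i (p.2 i))) W0 t‖ ^ 2
                ∂((Measure.pi fun _ : Fin n => μ).prod (Measure.pi fun _ : Fin n => μ))) := by
  
  have hB0 : 0 ≤ Bφ' := (abs_nonneg _).trans (hBφ' 0)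
  have hn0 : (0 : ℝ) < n := by exact_mod_cast hn
  set ν : Measure (Fin n → Input d × ℝ) := Measure.pi fun _ : Fin n => μ with hνdef
  obtain ⟨R, hR⟩ := iter_bdd (n := n) hφ hBφ' hu Cx Cy η W0 t
  have hFm := meas_iter (n := n) (u := u) hφ η W0 t
  set F : (Fin n → Input d × ℝ) → Param d m := fun S => gdIter η (empRisk φ u S) W0 t with hF
  have hFe : ∀ S, gdIter η (empRisk φ u S) W0 t = F S := fun _ => rfl
  simp only [hFe] at hR ⊢
  have hν : ∀ᵐ S ∂ν, ∀ i, Good Cx Cy (S i) := by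
    rw [ae_all_iff]
    intro i
    exact (measurePreserving_eval (fun _ : Fin n => μ) i).quasiMeasurePreserving.ae hsupp
  have hP1 : ∀ᵐ p ∂(ν.prod ν), ∀ i, Good Cx Cy (p.1 i) := Measure.quasiMeasurePreserving_fst.ae hν
  have hP2 : ∀ᵐ p ∂(ν.prod ν), ∀ i, Good Cx Cy (p.2 i) := Measure.quasiMeasurePreserving_snd.ae hν
  have hM : ∃ M : ℝ, ∀ (W : Param d m) (z : Input d × ℝ), ‖W‖ ≤ R → Good Cx Cy z → ‖sqLoss φ u W z‖ ≤ M := by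
    refine ⟨(Bφ' * Cx * R + |∑ k : Fin m, u k * φ 0| + Cy) ^ 2 / 2, fun W z hW hz => ?_⟩
    have h := net_bdd hφ hBφ' hu W z hz hW
    unfold sqLoss
    rw [Real.norm_of_nonneg (by positivity), ← sq_abs]
    gcongr
  obtain ⟨M, hM⟩ := hM
  have I1 : Integrable (fun q : (Fin n → Input d × ℝ) × (Input d × ℝ) => sqLoss φ u (F q.1) q.2)
      (ν.prod μ) := by
    refine Integrable.of_bound (C := M) ?_ ?_
    · exact ((meas_loss hφ).comp ((hFm.comp measurable_fst).prodMk measurable_snd)).aestronglyMeasurable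
    · have g1 : ∀ᵐ q ∂(ν.prod μ), ∀ i, Good Cx Cy (q.1 i) := Measure.quasiMeasurePreserving_fst.ae hν
      have g2 : ∀ᵐ q ∂(ν.prod μ), Good Cx Cy q.2 := Measure.quasiMeasurePreserving_snd.ae hsupp
      filter_upwards [g1, g2] with q h1 h2 using hM _ _ (hR _ h1) h2
  have I2 : ∀ i, Integrable (fun p : (Fin n → Input d × ℝ) × (Fin n → Input d × ℝ) =>
      sqLoss φ u (F p.1) (p.1 i)) (ν.prod ν) := by
    intro i
    refine Integrable.of_bound (C := M) ?_ ?_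
    · exact ((meas_loss hφ).comp ((hFm.comp measurable_fst).prodMk
        ((measurable_pi_apply i).comp measurable_fst))).aestronglyMeasurable
    · filter_upwards [hP1] with p h1 using hM _ _ (hR _ h1) (h1 i)
  have mp : ∀ i, MeasurePreserving (fun p : (Fin n → Input d × ℝ) × (Fin n → Input d × ℝ) =>
      (Function.update p.1 i (p.2 i), p.1 i)) (ν.prod ν) (ν.prod μ) := by
    intro i
    have h1 : MeasurePreserving (Prod.map id (Function.eval i)) (ν.prod ν) (ν.prod μ) :=
      (MeasurePreserving.id ν).prod (measurePreserving_eval (fun _ : Fin n => μ) i)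
    have h2 := h1.comp (mp_swapAt μ i)
    convert h2 using 1
    funext p
    simp [swapAt]
  have I3 : ∀ i, Integrable (fun p : (Fin n → Input d × ℝ) × (Fin n → Input d × ℝ) =>
      sqLoss φ u (F (Function.update p.1 i (p.2 i))) (p.1 i)) (ν.prod ν) := fun i =>
    ((mp i).integrable_comp I1.aestronglyMeasurable).2 I1
  have E : ∀ i, ∫ p, sqLoss φ u (F (Function.update p.1 i (p.2 i))) (p.1 i) ∂(ν.prod ν)
      = ∫ p : (Fin n → Input d × ℝ) × (Fin n → Input d × ℝ),
        (∫ z, sqLoss φ u (F p.1) z ∂μ) ∂(ν.prod ν) := by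
    intro i
    rw [integral_fun_fst (fun S => ∫ z, sqLoss φ u (F S) z ∂μ)]
    have h1 := integral_prod _ I1
    simp only [probReal_univ, one_smul]
    rw [← h1]
    have h2 := I1.aestronglyMeasurable
    rw [← (mp i).map_eq] at h2
    have h3 := integral_map (mp i).measurable.aemeasurable h2
    rw [(mp i).map_eq] at h3
    exact h3.symm
  have IG : Integrable (fun p : (Fin n → Input d × ℝ) × (Fin n → Input d × ℝ) =>
      ∫ z, sqLoss φ u (F p.1) z ∂μ) (ν.prod ν) := I1.integral_prod_left.comp_fst ν
  have I4 : ∀ i, Integrable (fun p : (Fin n → Input d × ℝ) × (Fin n → Input d × ℝ) =>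
      ‖F p.1 - F (Function.update p.1 i (p.2 i))‖ ^ 2) (ν.prod ν) := by
    intro i
    refine Integrable.of_bound (C := (R + R) ^ 2) ?_ ?_
    · have hm : Measurable (fun p : (Fin n → Input d × ℝ) × (Fin n → Input d × ℝ) =>
        Function.update p.1 i (p.2 i)) := (mp i).measurable.fst
      exact (((hFm.comp measurable_fst).sub (hFm.comp hm)).norm.pow_const 2).aestronglyMeasurable
    · filter_upwards [hP1, hP2] with p h1 h2
      have h3 : ∀ j, Good Cx Cy (Function.update p.1 i (p.2 i) j) := by
        intro j
        by_cases h : j = i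
        · subst h
          simpa using h2 j
        · simpa [h] using h1 j
      rw [Real.norm_of_nonneg (by positivity)]
      gcongr
      exact (norm_sub_le _ _).trans (add_le_add (hR _ h1) (hR _ h3))
  have hemp : ∀ p : (Fin n → Input d × ℝ) × (Fin n → Input d × ℝ),
      empRisk φ u p.1 (F p.1) = (1 / (n : ℝ)) * ∑ i, sqLoss φ u (F p.1) (p.1 i) := by
    intro p
    unfold empRisk
    ring
  have IE : Integrable (fun p : (Fin n → Input d × ℝ) × (Fin n → Input d × ℝ) =>
      empRisk φ u p.1 (F p.1)) (ν.prod ν) := by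
    simp only [hemp]
    exact (integrable_finsetSum _ fun i _ => I2 i).const_mul _
  have hA : ∫ p, empRisk φ u p.1 (F p.1) ∂(ν.prod ν)
      = (1 / (n : ℝ)) * ∑ i, ∫ p, sqLoss φ u (F p.1) (p.1 i) ∂(ν.prod ν) := by
    simp only [hemp]
    rw [integral_const_mul, integral_finsetSum _ fun i _ => I2 i]
  rw [integral_sub IG IE]
  set Gv := ∫ p : (Fin n → Input d × ℝ) × (Fin n → Input d × ℝ),
        (∫ z, sqLoss φ u (F p.1) z ∂μ) ∂(ν.prod ν)
  have hA0 : 0 ≤ ∫ p, empRisk φ u p.1 (F p.1) ∂(ν.prod ν) := by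
    refine integral_nonneg fun p => ?_
    simp only [Pi.zero_apply, empRisk, sqLoss]
    positivity
  set A := ∫ p, empRisk φ u p.1 (F p.1) ∂(ν.prod ν)
  set Δ : Fin n → ℝ := fun i => ∫ p, ‖F p.1 - F (Function.update p.1 i (p.2 i))‖ ^ 2 ∂(ν.prod ν)
    with hΔ
  have hΔe : ∀ i, ∫ p, ‖F p.1 - F (Function.update p.1 i (p.2 i))‖ ^ 2 ∂(ν.prod ν) = Δ i :=
    fun _ => rfl
  have hΔ0 : ∀ i, 0 ≤ Δ i := fun i => integral_nonneg fun p => by positivity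
  have hD0 : 0 ≤ (1 / (n : ℝ)) * ∑ i, Δ i :=
    mul_nonneg (by positivity) (Finset.sum_nonneg fun i _ => hΔ0 i)
  set D := (1 / (n : ℝ)) * ∑ i, Δ i
  rw [← sub_le_iff_le_add]
  refine key_real hA0 hD0 (by positivity) fun c hc => ?_
  have hi : ∀ i, Gv - ∫ p, sqLoss φ u (F p.1) (p.1 i) ∂(ν.prod ν) ≤
      (Real.sqrt 2 * Bφ' * Cx) * (c / 2 * (∫ p, sqLoss φ u (F p.1) (p.1 i) ∂(ν.prod ν))
      + Δ i / (2 * c)) + (1 / 2) * Bφ' ^ 2 * Cx ^ 2 * Δ i := by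
    intro i
    rw [← E i, ← integral_sub (I3 i) (I2 i)]
    have J1 := (((I2 i).const_mul (c / 2)).add ((I4 i).div_const (2 * c))).const_mul
      (Real.sqrt 2 * Bφ' * Cx)
    have J2 := (I4 i).const_mul ((1 / 2) * Bφ' ^ 2 * Cx ^ 2)
    have h := integral_mono_ae ((I3 i).sub (I2 i)) (J1.add J2) (by
      filter_upwards [hP1] with p h1
      exact loss_diff hφ hBφ' hu _ _ _ (h1 i) hc)
    refine h.trans (le_of_eq ?_)
    rw [integral_add' J1 J2, integral_const_mul, integral_const_mul,
      integral_add' ((I2 i).const_mul (c / 2)) ((I4 i).div_const (2 * c)), integral_const_mul,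
      integral_div]
  have hsum := Finset.sum_le_sum fun i (_ : i ∈ Finset.univ) => hi i
  simp only [Finset.sum_sub_distrib, Finset.sum_add_distrib, ← Finset.mul_sum, ← Finset.sum_div,
    Finset.sum_const, Finset.card_univ, Fintype.card_fin, nsmul_eq_mul] at hsum
  have h5 := mul_le_mul_of_nonneg_left hsum (show 0 ≤ 1 / (n : ℝ) by positivity)
  have h6 : 1 / (n : ℝ) * (n * Gv) = Gv := by field_simp
  have hD : D = (1 / (n : ℝ)) * ∑ i, Δ i := rfl
  rw [mul_sub, h6, ← hA] at h5
  rw [sub_le_iff_le_add]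
  refine h5.trans (le_of_eq ?_)
  rw [hA, hD]
  ring
end

section
/- (Almost co-coercivity of the gradient operator) Fix t ≥ 1 and i ∈ {1,…,n}, and suppose η ≤ 1/(2ρ). Then the gradient-descent iterates W_t on S and W_t^{(i)} on S^{(i)} satisfy ⟨W_t − W_t^{(i)}, ∇L_{S∖i}(W_t) − ∇L_{S∖i}(W_t^{(i)})⟩ ≥ 2η(1 − ηρ/2) ‖∇L_{S∖i}(W_t) − ∇L_{S∖i}(W_t^{(i)})‖_F² − ε ‖W_t − W_t^{(i)} − η(∇L_{S∖i}(W_t) − ∇L_{S∖i}(W_t^{(i)}))‖_F², where ε = 2 C_x² √C_0 B_{φ''} (4 B_{φ'} C_x √(ηt) + √2)/√m. -/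
open MeasureTheory Finset
open scoped BigOperators

/-- Leave-one-out empirical risk `L_{S∖i}(W) = L_S(W) − ℓ(W, zᵢ)/n`. -/
noncomputable def looRisk {d m n : ℕ} (φ : ℝ → ℝ) (u : Fin m → ℝ)
    (S : Fin n → Input d × ℝ) (i : Fin n) (W : Param d m) : ℝ :=
  empRisk φ u S W - sqLoss φ u W (S i) / n

section helpers

/-- One-dimensional second-order lower Taylor bound. -/
lemma aux_taylor (g g1 g2 : ℝ → ℝ) (c : ℝ)
    (h1 : ∀ a, HasDerivAt g (g1 a) a) (h2 : ∀ a, HasDerivAt g1 (g2 a) a)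
    (hc : ∀ a ∈ Set.Icc (0:ℝ) 1, c ≤ g2 a) : g 0 + g1 0 + c / 2 ≤ g 1 := by
  have m1 : MonotoneOn (fun a => g1 a - c * a) (Set.Icc (0:ℝ) 1) := by
    have hd : ∀ a, HasDerivAt (fun a => g1 a - c * a) (g2 a - c) a := fun a => by
      simpa using (h2 a).fun_sub ((hasDerivAt_id a).const_mul c)
    refine monotoneOn_of_deriv_nonneg (convex_Icc 0 1)
      (fun a _ => (hd a).continuousAt.continuousWithinAt)
      (fun a _ => (hd a).differentiableAt.differentiableWithinAt) ?_
    intro a ha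
    rw [(hd a).deriv]
    have := hc a (interior_subset ha)
    linarith
  have m2 : MonotoneOn (fun a => g a - g1 0 * a - c / 2 * a ^ 2) (Set.Icc (0:ℝ) 1) := by
    have hd : ∀ a, HasDerivAt (fun a => g a - g1 0 * a - c / 2 * a ^ 2) (g1 a - g1 0 - c * a) a :=
      fun a => by
        have := ((h1 a).sub ((hasDerivAt_id a).const_mul (g1 0))).sub
          (((hasDerivAt_id a).pow 2).const_mul (c / 2))
        refine (this.congr_deriv ?_)
        simp; ring
    refine monotoneOn_of_deriv_nonneg (convex_Icc 0 1)
      (fun a _ => (hd a).continuousAt.continuousWithinAt)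
      (fun a _ => (hd a).differentiableAt.differentiableWithinAt) ?_
    intro a ha
    rw [(hd a).deriv]
    have ha' := interior_subset ha
    have := m1 (Set.left_mem_Icc.2 zero_le_one) ha' ha'.1
    simp at this
    linarith
  have := m2 (Set.left_mem_Icc.2 zero_le_one) (Set.right_mem_Icc.2 zero_le_one) zero_le_one
  simp at this
  linarith

lemma aux_cocoer {E : Type*} [NormedAddCommGroup E] [InnerProductSpace ℝ E]
    (P : E → ℝ) (G : E → E) (ρ ε η : ℝ) (w w' : E)
    (hup : ∀ W D, P (W + D) ≤ P W + inner ℝ (G W) D + ρ / 2 * ‖D‖ ^ 2)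
    (hlo1 : P w' + inner ℝ (G w') (w - w' - η • (G w - G w'))
      - ε / 2 * ‖w - w' - η • (G w - G w')‖ ^ 2 ≤ P (w' + (w - w' - η • (G w - G w'))))
    (hlo2 : P w + inner ℝ (G w) (-(w - w' - η • (G w - G w')))
      - ε / 2 * ‖-(w - w' - η • (G w - G w'))‖ ^ 2 ≤ P (w + -(w - w' - η • (G w - G w')))) :
    2 * η * (1 - η * ρ / 2) * ‖G w - G w'‖ ^ 2
      - ε * ‖w - w' - η • (G w - G w')‖ ^ 2 ≤ inner ℝ (w - w') (G w - G w') := by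
  have e1 : w' + (w - w' - η • (G w - G w')) = w + (-η) • (G w - G w') := by
    rw [neg_smul]; abel
  have e2 : w + -(w - w' - η • (G w - G w')) = w' + η • (G w - G w') := by abel
  have u1 := hup w ((-η) • (G w - G w'))
  have u2 := hup w' (η • (G w - G w'))
  rw [e1] at hlo1
  rw [e2, norm_neg] at hlo2
  rw [norm_smul, mul_pow] at u1 u2
  simp only [Real.norm_eq_abs, sq_abs] at u1 u2
  have k1 := hlo1.trans u1
  have k2 := hlo2.trans u2
  set Δ := G w - G w' with hΔ
  have e3 : inner ℝ (G w) Δ - inner ℝ (G w') Δ = ‖Δ‖ ^ 2 := by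
    rw [← inner_sub_left, ← hΔ, real_inner_self_eq_norm_sq]
  have e4 : inner ℝ (w - w') Δ = inner ℝ (G w) (w - w') - inner ℝ (G w') (w - w') := by
    rw [← inner_sub_left, ← hΔ, real_inner_comm]
  rw [inner_neg_right] at k2
  rw [inner_sub_right (G w') (w - w')] at k1
  rw [inner_sub_right (G w) (w - w')] at k2
  simp only [inner_smul_right] at k1 k2
  rw [e4]
  have e5 := congrArg (fun r => η * r) e3
  simp only [mul_sub] at e5
  nlinarith [k1, k2, e5]

lemma aux_step {E : Type*} [NormedAddCommGroup E] [InnerProductSpace ℝ E]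
    (P : E → ℝ) (G : E → E) (ρ η : ℝ) (hη0 : 0 < η) (hηρ : η * ρ ≤ 1 / 2)
    (hup : ∀ W D, P (W + D) ≤ P W + inner ℝ (G W) D + ρ / 2 * ‖D‖ ^ 2) (W : E) :
    ‖η • G W‖ ^ 2 ≤ 2 * η * (P W - P (W - η • G W)) := by
  have u := hup W (-(η • G W))
  rw [← sub_eq_add_neg, norm_neg, inner_neg_right, inner_smul_right,
    real_inner_self_eq_norm_sq] at u
  rw [norm_smul, mul_pow, Real.norm_eq_abs, sq_abs] at *
  have h0 : 0 ≤ ‖G W‖ ^ 2 * η := by positivity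
  have h1 := mul_le_mul_of_nonneg_left hηρ h0
  have : η * ‖G W‖ ^ 2 ≤ 2 * (P W - P (W - η • G W)) := by nlinarith
  nlinarith

lemma aux_gd {E : Type*} [NormedAddCommGroup E] [InnerProductSpace ℝ E]
    (P : E → ℝ) (G : E → E) (ρ η : ℝ) (hη0 : 0 < η) (hηρ : η * ρ ≤ 1 / 2)
    (hup : ∀ W D, P (W + D) ≤ P W + inner ℝ (G W) D + ρ / 2 * ‖D‖ ^ 2)
    (w : ℕ → E) (hw : ∀ s, w (s + 1) = w s - η • G (w s)) (t : ℕ) :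
    ‖w t - w 0‖ ^ 2 ≤ t * (2 * η * (P (w 0) - P (w t))) ∧ P (w t) ≤ P (w 0) := by
  induction t with
  | zero => simp
  | succ t ih =>
    have st := aux_step P G ρ η hη0 hηρ hup (w t)
    rw [← hw] at st
    obtain ⟨ih1, ih2⟩ := ih
    have hdec : P (w (t + 1)) ≤ P (w t) := by
      have := (sq_nonneg _).trans st
      have := nonneg_of_mul_nonneg_right this (by positivity)
      linarith
    refine ⟨?_, hdec.trans ih2⟩
    have tri : ‖w (t + 1) - w 0‖ ≤ ‖w t - w 0‖ + ‖η • G (w t)‖ := by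
      have : w (t + 1) - w 0 = (w t - w 0) - η • G (w t) := by rw [hw]; abel
      rw [this]; exact norm_sub_le _ _
    have tri2 : ‖w (t + 1) - w 0‖ ^ 2 ≤ (‖w t - w 0‖ + ‖η • G (w t)‖) ^ 2 := by gcongr
    refine tri2.trans ?_
    generalize ‖w t - w 0‖ = a at *
    generalize ‖η • G (w t)‖ = b at *
    have hX : 0 ≤ 2 * η * (P (w 0) - P (w t)) := by
      have : 0 ≤ P (w 0) - P (w t) := by linarith
      positivity
    have e : 2 * η * (P (w 0) - P (w (t + 1)))
      = 2 * η * (P (w 0) - P (w t)) + 2 * η * (P (w t) - P (w (t + 1))) := by ring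
    rw [e]
    generalize 2 * η * (P (w 0) - P (w t)) = X at *
    generalize 2 * η * (P (w t) - P (w (t + 1))) = Y at *
    push_cast
    rcases Nat.eq_zero_or_pos t with h | h
    · subst h
      simp at ih1 ⊢
      subst ih1
      simp
      linarith
    · have hT : (1:ℝ) ≤ t := by exact_mod_cast h
      generalize (t:ℝ) = T at *
      have h1 : 0 ≤ (a - T * b) ^ 2 := sq_nonneg _
      have h2 : T * (a + b) ^ 2 ≤ T * ((T + 1) * (X + Y)) := by
        have : T * (a + b) ^ 2 ≤ (T + 1) * a ^ 2 + T * (T + 1) * b ^ 2 := by nlinarith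
        refine this.trans ?_
        have h3 : (T + 1) * a ^ 2 ≤ (T + 1) * (T * X) := by gcongr
        have h4 : T * (T + 1) * b ^ 2 ≤ T * (T + 1) * Y := by gcongr
        linarith
      exact le_of_mul_le_mul_left h2 (by linarith)

/-- Preactivation. -/
def aux_pre {d m : ℕ} (x : Input d) (k : Fin m) (W : Param d m) : ℝ := ∑ j : Fin d, W (k, j) * x j

lemma aux_pre_line {d m : ℕ} (x : Input d) (k : Fin m) (W D : Param d m) (a : ℝ) :
    aux_pre x k (W + a • D) = aux_pre x k W + a * aux_pre x k D := by
  simp only [aux_pre, PiLp.add_apply, PiLp.smul_apply, smul_eq_mul, Finset.mul_sum,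
    ← Finset.sum_add_distrib]
  exact Finset.sum_congr rfl fun j _ => by ring

lemma aux_pre_sq {d m : ℕ} (x : Input d) (Cx : ℝ) (hx : ‖x‖ ≤ Cx) (D : Param d m) :
    ∑ k, aux_pre x k D ^ 2 ≤ Cx ^ 2 * ‖D‖ ^ 2 := by
  have hx2 : ∑ j, x j ^ 2 ≤ Cx ^ 2 := by
    have : ‖x‖ ^ 2 ≤ Cx ^ 2 := by gcongr
    rw [EuclideanSpace.norm_sq_eq] at this
    simpa using this
  rw [EuclideanSpace.norm_sq_eq, Fintype.sum_prod_type, Finset.mul_sum]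
  refine Finset.sum_le_sum fun k _ => ?_
  have := Finset.sum_mul_sq_le_sq_mul_sq Finset.univ (fun j => D (k, j)) (fun j => x j)
  refine this.trans ?_
  rw [mul_comm]
  simp only [Real.norm_eq_abs, sq_abs]
  exact mul_le_mul_of_nonneg_right hx2 (Finset.sum_nonneg fun _ _ => sq_nonneg _)

lemma aux_u_sq {m : ℕ} (hm : 1 ≤ m) (u : Fin m → ℝ)
    (hu : ∀ k, u k = 1 / Real.sqrt m ∨ u k = -(1 / Real.sqrt m)) : ∑ k, u k ^ 2 = 1 := by
  have : ∀ k, u k ^ 2 = 1 / m := fun k => by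
    rcases hu k with h | h <;> rw [h] <;> simp
  have hm' : (m:ℝ) ≠ 0 := by positivity
  simp [this, hm']

lemma aux_u_abs {m : ℕ} (u : Fin m → ℝ)
    (hu : ∀ k, u k = 1 / Real.sqrt m ∨ u k = -(1 / Real.sqrt m)) (k : Fin m) :
    |u k| = 1 / Real.sqrt m := by
  have : 0 ≤ 1 / Real.sqrt m := by positivity
  rcases hu k with h | h <;> rw [h]
  · exact abs_of_nonneg this
  · rw [abs_neg]; exact abs_of_nonneg this

lemma aux_u_cs {m : ℕ} (hm : 1 ≤ m) (u : Fin m → ℝ)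
    (hu : ∀ k, u k = 1 / Real.sqrt m ∨ u k = -(1 / Real.sqrt m)) (v b : Fin m → ℝ) (B : ℝ)
    (hv : ∀ k, |v k| ≤ B * |b k|) : (∑ k, u k * v k) ^ 2 ≤ B ^ 2 * ∑ k, b k ^ 2 := by
  have := Finset.sum_mul_sq_le_sq_mul_sq Finset.univ u v
  rw [aux_u_sq hm u hu, one_mul] at this
  refine this.trans ?_
  rw [Finset.mul_sum]
  refine Finset.sum_le_sum fun k _ => ?_
  rw [← sq_abs (v k), ← sq_abs (b k), ← mul_pow]
  have := hv k
  gcongr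

lemma aux_nnet {d m : ℕ} (φ : ℝ → ℝ) (u : Fin m → ℝ) (W : Param d m) (x : Input d) :
    nnet φ u W x = ∑ k, u k * φ (aux_pre x k W) := rfl

lemma aux_nnet_lip {d m : ℕ} (hm : 1 ≤ m) (φ : ℝ → ℝ) (B : ℝ) (hφ : Differentiable ℝ φ)
    (hB : ∀ s, |deriv φ s| ≤ B) (u : Fin m → ℝ)
    (hu : ∀ k, u k = 1 / Real.sqrt m ∨ u k = -(1 / Real.sqrt m))
    (Cx : ℝ) (x : Input d) (hx : ‖x‖ ≤ Cx) (W D : Param d m) :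
    |nnet φ u (W + D) x - nnet φ u W x| ≤ B * Cx * ‖D‖ := by
  have hB0 : 0 ≤ B := (abs_nonneg _).trans (hB 0)
  have hC0 : 0 ≤ Cx := (norm_nonneg _).trans hx
  refine abs_le_of_sq_le_sq ?_ (by positivity)
  rw [aux_nnet, aux_nnet, ← Finset.sum_sub_distrib]
  simp only [← mul_sub]
  refine (aux_u_cs hm u hu _ (fun k => aux_pre x k D) B ?_).trans ?_
  · intro k
    have e := aux_pre_line x k W D 1
    rw [one_smul, one_mul] at e
    have := Convex.norm_image_sub_le_of_norm_deriv_le (f := φ) (C := B) (s := Set.univ)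
      (x := aux_pre x k W) (y := aux_pre x k (W + D))
      (fun s _ => hφ s) (fun s _ => hB s) convex_univ trivial trivial
    rw [e, add_sub_cancel_left] at this
    rw [e]
    simpa using this
  · have := aux_pre_sq x Cx hx D
    calc _ ≤ B ^ 2 * (Cx ^ 2 * ‖D‖ ^ 2) := by gcongr
      _ = _ := by ring

lemma aux_nnet_bd {d m : ℕ} (hm : 1 ≤ m) (φ : ℝ → ℝ) (B : ℝ) (hB : ∀ s, |φ s| ≤ B) (u : Fin m → ℝ)
    (hu : ∀ k, u k = 1 / Real.sqrt m ∨ u k = -(1 / Real.sqrt m)) (W : Param d m) (x : Input d) :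
    |nnet φ u W x| ≤ B * Real.sqrt m := by
  have hB0 : 0 ≤ B := (abs_nonneg _).trans (hB 0)
  refine abs_le_of_sq_le_sq ?_ (by positivity)
  rw [aux_nnet]
  refine (aux_u_cs hm u hu _ (fun _ => 1) B ?_).trans ?_
  · intro k; simpa using hB _
  · simp [mul_pow]

lemma aux_diff {d m : ℕ} (φ : ℝ → ℝ) (hφ : Differentiable ℝ φ) (u : Fin m → ℝ) (z : Input d × ℝ) :
    Differentiable ℝ (fun W : Param d m => sqLoss φ u W z) := by
  unfold sqLoss nnet
  fun_prop

/-- second-order Taylor bounds for the loss at one sample -/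
lemma aux_loss {d m : ℕ} (hm : 1 ≤ m) 
    (φ : ℝ → ℝ) (Bφ Bφ' Bφ'' : ℝ)
    (hφ : Differentiable ℝ φ) (hφ' : Differentiable ℝ (deriv φ))
    (hBφ : ∀ s : ℝ, |φ s| ≤ Bφ) (hBφ' : ∀ s : ℝ, |deriv φ s| ≤ Bφ')
    (hBφ'' : ∀ s : ℝ, |deriv (deriv φ) s| ≤ Bφ'')
    (u : Fin m → ℝ) (hu : ∀ k, u k = 1 / Real.sqrt m ∨ u k = -(1 / Real.sqrt m))
    (Cx Cy : ℝ) (z : Input d × ℝ) (hx : ‖z.1‖ ≤ Cx) (hy : |z.2| ≤ Cy)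
    (ρ : ℝ) (hρ : ρ = Cx ^ 2 * (Bφ' ^ 2 + Bφ'' * Bφ + Bφ'' * Cy / Real.sqrt m))
    (W D : Param d m) :
    sqLoss φ u (W + D) z ≤ sqLoss φ u W z + fderiv ℝ (fun W => sqLoss φ u W z) W D
        + ρ / 2 * ‖D‖ ^ 2 ∧
    ∀ r : ℝ, (∀ a ∈ Set.Icc (0:ℝ) 1, |nnet φ u (W + a • D) z.1 - z.2| ≤ r) →
      sqLoss φ u W z + fderiv ℝ (fun W => sqLoss φ u W z) W D
        - (Cx ^ 2 * Bφ'' * r / Real.sqrt m) / 2 * ‖D‖ ^ 2 ≤ sqLoss φ u (W + D) z := by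
  obtain ⟨x, y⟩ := z
  simp only at hx hy ⊢
  have hB0 : 0 ≤ Bφ := (abs_nonneg _).trans (hBφ 0)
  have hB1 : 0 ≤ Bφ' := (abs_nonneg _).trans (hBφ' 0)
  have hB2 : 0 ≤ Bφ'' := (abs_nonneg _).trans (hBφ'' 0)
  have hs : 0 < Real.sqrt m := Real.sqrt_pos.2 (by exact_mod_cast hm)
  let b : Fin m → ℝ := fun k => aux_pre x k D
  let f : ℝ → ℝ := fun a => nnet φ u (W + a • D) x
  let f1 : ℝ → ℝ := fun a => ∑ k, u k * (deriv φ (aux_pre x k W + a * b k) * b k)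
  let f2 : ℝ → ℝ := fun a => ∑ k, u k * (deriv (deriv φ) (aux_pre x k W + a * b k) * b k * b k)
  have hl : ∀ k a, HasDerivAt (fun a : ℝ => aux_pre x k W + a * b k) (b k) a := fun k a => by
    simpa using ((hasDerivAt_id a).mul_const (b k)).const_add (aux_pre x k W)
  have hf : ∀ a, HasDerivAt f (f1 a) a := fun a => by
    have : f = fun a => ∑ k, u k * φ (aux_pre x k W + a * b k) := by
      funext a; simp only [f, aux_nnet, aux_pre_line, b]
    rw [this]
    refine HasDerivAt.fun_sum fun k _ => HasDerivAt.const_mul _ ?_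
    exact (hφ _).hasDerivAt.comp a (hl k a)
  have hf1 : ∀ a, HasDerivAt f1 (f2 a) a := fun a => by
    refine HasDerivAt.fun_sum fun k _ => HasDerivAt.const_mul _ (HasDerivAt.mul_const ?_ _)
    exact (hφ' _).hasDerivAt.comp a (hl k a)
  let g : ℝ → ℝ := fun a => sqLoss φ u (W + a • D) (x, y)
  have hg : ∀ a, HasDerivAt g ((f a - y) * f1 a) a := fun a => by
    have := (((hf a).sub_const y).pow 2).div_const 2
    refine this.congr_deriv ?_
    simp; ring
  have hg1 : ∀ a, HasDerivAt (fun a => (f a - y) * f1 a) (f1 a * f1 a + (f a - y) * f2 a) a :=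
    fun a => ((hf a).sub_const y).mul (hf1 a)
  have hg0 : (f 0 - y) * f1 0 = fderiv ℝ (fun W => sqLoss φ u W (x, y)) W D := by
    have h1 := (aux_diff φ hφ u (x, y) W).hasFDerivAt
    have h2 : HasDerivAt (fun a : ℝ => W + a • D) D 0 := by
      simpa using ((hasDerivAt_id (0:ℝ)).smul_const D).const_add W
    have h1' : HasFDerivAt (fun W => sqLoss φ u W (x, y))
      (fderiv ℝ (fun W => sqLoss φ u W (x, y)) W) (W + (0:ℝ) • D) := by simpa using h1
    have h3 := h1'.comp_hasDerivAt (0:ℝ) h2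
    exact (hg 0).unique h3
  have hbsq : ∑ k, b k ^ 2 ≤ Cx ^ 2 * ‖D‖ ^ 2 := aux_pre_sq x Cx hx D
  have hF2 : ∀ a, |f2 a| ≤ Bφ'' * Cx ^ 2 / Real.sqrt m * ‖D‖ ^ 2 := fun a => by
    calc |f2 a| ≤ ∑ k, |u k * (deriv (deriv φ) (aux_pre x k W + a * b k) * b k * b k)| :=
          Finset.abs_sum_le_sum_abs _ _
      _ ≤ ∑ k, 1 / Real.sqrt m * Bφ'' * b k ^ 2 := by
          refine Finset.sum_le_sum fun k _ => ?_
          rw [abs_mul, aux_u_abs u hu, mul_assoc, mul_assoc (1 / _), ← pow_two, abs_mul,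
            abs_of_nonneg (sq_nonneg (b k))]
          have := hBφ'' (aux_pre x k W + a * b k)
          gcongr
      _ = 1 / Real.sqrt m * Bφ'' * ∑ k, b k ^ 2 := by rw [Finset.mul_sum]
      _ ≤ 1 / Real.sqrt m * Bφ'' * (Cx ^ 2 * ‖D‖ ^ 2) := by gcongr
      _ = _ := by ring
  have hF1 : ∀ a, f1 a ^ 2 ≤ Bφ' ^ 2 * (Cx ^ 2 * ‖D‖ ^ 2) := fun a => by
    refine (aux_u_cs hm u hu _ b Bφ' ?_).trans (by gcongr)
    intro k
    rw [abs_mul]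
    have := hBφ' (aux_pre x k W + a * b k)
    gcongr
  have g0e : g 0 = sqLoss φ u W (x, y) := by simp [g]
  have g1e : g 1 = sqLoss φ u (W + D) (x, y) := by simp [g]
  have hprod : ∀ a r, |f a - y| ≤ r → |(f a - y) * f2 a|
      ≤ r * (Bφ'' * Cx ^ 2 / Real.sqrt m * ‖D‖ ^ 2) := fun a r hr => by
    rw [abs_mul]
    exact mul_le_mul hr (hF2 a) (abs_nonneg _) ((abs_nonneg _).trans hr)
  constructor
  · have := aux_taylor (fun a => - g a) (fun a => - ((f a - y) * f1 a))
      (fun a => -(f1 a * f1 a + (f a - y) * f2 a)) (-(ρ * ‖D‖ ^ 2))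
      (fun a => (hg a).neg) (fun a => (hg1 a).neg) ?_
    · simp only [hg0, g0e, g1e] at this
      linarith
    · intro a _
      have hr : |f a - y| ≤ Bφ * Real.sqrt m + Cy :=
        (abs_sub _ _).trans (add_le_add (aux_nnet_bd hm φ Bφ hBφ u hu _ x) hy)
      have h1 := (le_abs_self _).trans (hprod a _ hr)
      have h2 := hF1 a
      have e : (Bφ * Real.sqrt m + Cy) * (Bφ'' * Cx ^ 2 / Real.sqrt m * ‖D‖ ^ 2)
        + Bφ' ^ 2 * (Cx ^ 2 * ‖D‖ ^ 2) = ρ * ‖D‖ ^ 2 := by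
        rw [hρ]; field_simp; ring
      linarith
  · intro r hr
    have := aux_taylor g (fun a => ((f a - y) * f1 a))
      (fun a => (f1 a * f1 a + (f a - y) * f2 a))
      (-((Cx ^ 2 * Bφ'' * r / Real.sqrt m) * ‖D‖ ^ 2)) hg hg1 ?_
    · simp only [hg0, g0e, g1e] at this
      linarith
    · intro a ha
      have h1 := (abs_le.1 (hprod a _ (hr a ha))).1
      have h2 := mul_self_nonneg (f1 a)
      have e : r * (Bφ'' * Cx ^ 2 / Real.sqrt m * ‖D‖ ^ 2)
        = (Cx ^ 2 * Bφ'' * r / Real.sqrt m) * ‖D‖ ^ 2 := by ring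
      linarith

/-- weighted risk -/
lemma aux_risk {d m n : ℕ} (hm : 1 ≤ m) 
    (φ : ℝ → ℝ) (Bφ Bφ' Bφ'' : ℝ)
    (hφ : Differentiable ℝ φ) (hφ' : Differentiable ℝ (deriv φ))
    (hBφ : ∀ s : ℝ, |φ s| ≤ Bφ) (hBφ' : ∀ s : ℝ, |deriv φ s| ≤ Bφ')
    (hBφ'' : ∀ s : ℝ, |deriv (deriv φ) s| ≤ Bφ'')
    (u : Fin m → ℝ) (hu : ∀ k, u k = 1 / Real.sqrt m ∨ u k = -(1 / Real.sqrt m))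
    (Cx Cy : ℝ) (S : Fin n → Input d × ℝ) (hx : ∀ j, ‖(S j).1‖ ≤ Cx) (hy : ∀ j, |(S j).2| ≤ Cy)
    (ρ : ℝ) (hρ : ρ = Cx ^ 2 * (Bφ' ^ 2 + Bφ'' * Bφ + Bφ'' * Cy / Real.sqrt m)) (hρ0 : 0 ≤ ρ)
    (P : Param d m → ℝ) (c : Fin n → ℝ) (hc : ∀ j, 0 ≤ c j) (hc1 : ∑ j, c j ≤ 1)
    (hP : P = fun W => ∑ j, c j * sqLoss φ u W (S j))
    (W D : Param d m) :
    P (W + D) ≤ P W + inner ℝ (gradient P W) D + ρ / 2 * ‖D‖ ^ 2 ∧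
    ∀ r : ℝ, 0 ≤ r → (∀ j, ∀ a ∈ Set.Icc (0:ℝ) 1, |nnet φ u (W + a • D) (S j).1 - (S j).2| ≤ r) →
      P W + inner ℝ (gradient P W) D
        - (Cx ^ 2 * Bφ'' * r / Real.sqrt m) / 2 * ‖D‖ ^ 2 ≤ P (W + D) := by
  have hB2 : 0 ≤ Bφ'' := (abs_nonneg _).trans (hBφ'' 0)
  have hg : inner ℝ (gradient P W) D = ∑ j, c j * fderiv ℝ (fun W => sqLoss φ u W (S j)) W D := by
    have h : HasFDerivAt P (∑ j, c j • fderiv ℝ (fun W => sqLoss φ u W (S j)) W) W := by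
      rw [hP]
      exact HasFDerivAt.fun_sum fun j _ => (aux_diff φ hφ u (S j) W).hasFDerivAt.const_mul (c j)
    rw [gradient, InnerProductSpace.toDual_symm_apply, h.fderiv]
    simp
  have key := fun j => aux_loss hm φ Bφ Bφ' Bφ'' hφ hφ' hBφ hBφ' hBφ'' u hu Cx Cy (S j) (hx j) (hy j)
    ρ hρ W D
  rw [hg, hP]
  simp only
  have gen : ∀ K : ℝ, 0 ≤ K → (∑ j, c j) * (K / 2 * ‖D‖ ^ 2) ≤ K / 2 * ‖D‖ ^ 2 := fun K hK =>
    mul_le_of_le_one_left (by positivity) hc1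
  constructor
  · have := Finset.sum_le_sum fun j (_ : j ∈ Finset.univ) =>
      mul_le_mul_of_nonneg_left (key j).1 (hc j)
    simp only [mul_add, Finset.sum_add_distrib] at this
    rw [← Finset.sum_mul] at this
    linarith [gen ρ hρ0]
  · intro r hr h
    have := Finset.sum_le_sum fun j (_ : j ∈ Finset.univ) =>
      mul_le_mul_of_nonneg_left ((key j).2 r (h j)) (hc j)
    simp only [mul_add, mul_sub, Finset.sum_add_distrib, Finset.sum_sub_distrib] at this
    rw [← Finset.sum_mul] at this
    linarith [gen (Cx ^ 2 * Bφ'' * r / Real.sqrt m) (by positivity)]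

lemma aux_emp {d m n : ℕ} (φ : ℝ → ℝ) (u : Fin m → ℝ) (S : Fin n → Input d × ℝ) :
    empRisk φ u S = fun W : Param d m => ∑ j, (1 / (n:ℝ)) * sqLoss φ u W (S j) := by
  funext W
  rw [← Finset.mul_sum, empRisk]; ring

lemma aux_loo {d m n : ℕ} (φ : ℝ → ℝ) (u : Fin m → ℝ) (S : Fin n → Input d × ℝ) (i : Fin n) :
    looRisk φ u S i = fun W : Param d m =>
      ∑ j, (if j = i then 0 else 1 / (n:ℝ)) * sqLoss φ u W (S j) := by
  funext W
  have : ∀ j, (if j = i then 0 else 1 / (n:ℝ)) * sqLoss φ u W (S j)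
    = (1 / (n:ℝ)) * sqLoss φ u W (S j) - if j = i then (1 / (n:ℝ)) * sqLoss φ u W (S j) else 0 := by
    intro j; split_ifs <;> ring
  simp only [this, Finset.sum_sub_distrib, Finset.sum_ite_eq', Finset.mem_univ, if_true]
  rw [looRisk, aux_emp]; ring

lemma aux_loss_nonneg {d m : ℕ} (φ : ℝ → ℝ) (u : Fin m → ℝ) (W : Param d m) (z : Input d × ℝ) :
    0 ≤ sqLoss φ u W z := by unfold sqLoss; positivity

lemma aux_loo_nonneg {d m n : ℕ} (φ : ℝ → ℝ) (u : Fin m → ℝ) (S : Fin n → Input d × ℝ) (i : Fin n)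
    (W : Param d m) : 0 ≤ looRisk φ u S i W := by
  rw [aux_loo]
  refine Finset.sum_nonneg fun j _ => mul_nonneg ?_ (aux_loss_nonneg _ _ _ _)
  split_ifs <;> positivity

lemma aux_loo_le {d m n : ℕ} (φ : ℝ → ℝ) (u : Fin m → ℝ) (S : Fin n → Input d × ℝ) (i : Fin n)
    (z : Input d × ℝ) (W : Param d m) :
    looRisk φ u S i W ≤ empRisk φ u (Function.update S i z) W := by
  rw [aux_loo, aux_emp]
  refine Finset.sum_le_sum fun j _ => ?_
  have := aux_loss_nonneg φ u W z
  by_cases h : j = i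
  · subst h; simp; positivity
  · simp [h]

lemma aux_emp_le {d m n : ℕ} (hn : 1 ≤ n) (φ : ℝ → ℝ) (u : Fin m → ℝ) (S : Fin n → Input d × ℝ)
    (W : Param d m) (C : ℝ) (h : ∀ j, sqLoss φ u W (S j) ≤ C) : empRisk φ u S W ≤ C := by
  have hn' : (0:ℝ) < n := by exact_mod_cast hn
  rw [empRisk, div_le_iff₀ hn']
  refine (Finset.sum_le_sum fun j _ => h j).trans ?_
  simp [mul_comm]

lemma aux_emp_nonneg {d m n : ℕ} (φ : ℝ → ℝ) (u : Fin m → ℝ) (S : Fin n → Input d × ℝ)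
    (W : Param d m) : 0 ≤ empRisk φ u S W :=
  div_nonneg (Finset.sum_nonneg fun j _ => aux_loss_nonneg _ _ _ _) (by positivity)

end helpers

/-- almost co-coercivity of the gradient operator (Lemma 6 of the paper). -/
theorem statement6 {d m n : ℕ} (hm : 1 ≤ m) (hn : 1 ≤ n)
    (φ : ℝ → ℝ) (Bφ Bφ' Bφ'' : ℝ)
    (hφ : Differentiable ℝ φ) (hφ' : Differentiable ℝ (deriv φ))
    (hBφ : ∀ s : ℝ, |φ s| ≤ Bφ) (hBφ' : ∀ s : ℝ, |deriv φ s| ≤ Bφ')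
    (hBφ'' : ∀ s : ℝ, |deriv (deriv φ) s| ≤ Bφ'')
    (u : Fin m → ℝ) (hu : ∀ k, u k = 1 / Real.sqrt m ∨ u k = -(1 / Real.sqrt m))
    (Cx Cy C0 : ℝ) (hCx : 0 < Cx) (hCy : 0 < Cy) (hC0 : 0 < C0)
    (S : Fin n → Input d × ℝ) (i : Fin n) (ztil : Input d × ℝ)
    (hx : ∀ j, ‖(S j).1‖ ≤ Cx) (hy : ∀ j, |(S j).2| ≤ Cy)
    (hxt : ‖ztil.1‖ ≤ Cx) (hyt : |ztil.2| ≤ Cy)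
    (W0 : Param d m)
    (hl0 : ∀ j, sqLoss φ u W0 (S j) ≤ C0) (hl0t : sqLoss φ u W0 ztil ≤ C0)
    (η : ℝ) (hη0 : 0 < η)
    (ρ : ℝ) (hρ : ρ = Cx ^ 2 * (Bφ' ^ 2 + Bφ'' * Bφ + Bφ'' * Cy / Real.sqrt m))
    (hη : η ≤ 1 / (2 * ρ))
    (t : ℕ) (ht : 1 ≤ t)
    (ε : ℝ) (hεdef : ε = 2 * Cx ^ 2 * Real.sqrt C0 * Bφ''
        * (4 * Bφ' * Cx * Real.sqrt (η * t) + Real.sqrt 2) / Real.sqrt m) :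
    (inner ℝ
        (gdIter η (empRisk φ u S) W0 t
          - gdIter η (empRisk φ u (Function.update S i ztil)) W0 t)
        (gradient (looRisk φ u S i) (gdIter η (empRisk φ u S) W0 t)
          - gradient (looRisk φ u S i)
              (gdIter η (empRisk φ u (Function.update S i ztil)) W0 t)) : ℝ)
      ≥ 2 * η * (1 - η * ρ / 2)
            * ‖gradient (looRisk φ u S i) (gdIter η (empRisk φ u S) W0 t)
                - gradient (looRisk φ u S i)
                    (gdIter η (empRisk φ u (Function.update S i ztil)) W0 t)‖ ^ 2
          - ε * ‖gdIter η (empRisk φ u S) W0 t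
                - gdIter η (empRisk φ u (Function.update S i ztil)) W0 t
                - η • (gradient (looRisk φ u S i) (gdIter η (empRisk φ u S) W0 t)
                    - gradient (looRisk φ u S i)
                        (gdIter η (empRisk φ u (Function.update S i ztil)) W0 t))‖ ^ 2 := by
  have hB0 : 0 ≤ Bφ := (abs_nonneg _).trans (hBφ 0)
  have hB1 : 0 ≤ Bφ' := (abs_nonneg _).trans (hBφ' 0)
  have hB2 : 0 ≤ Bφ'' := (abs_nonneg _).trans (hBφ'' 0)
  have hn' : (0:ℝ) < n := by exact_mod_cast hn
  have hρ0 : 0 ≤ ρ := by rw [hρ]; positivity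
  have hηρ : η * ρ ≤ 1 / 2 := by
    rcases hρ0.eq_or_lt with h | h
    · rw [← h]; simp
    · calc η * ρ ≤ 1 / (2 * ρ) * ρ := by gcongr
        _ = 1 / 2 := by field_simp
  have ht' : (1:ℝ) ≤ t := by exact_mod_cast ht
  set S' := Function.update S i ztil with hS'
  have hx' : ∀ j, ‖(S' j).1‖ ≤ Cx := fun j => by
    by_cases h : j = i
    · subst h; simpa [hS'] using hxt
    · simpa [hS', h] using hx j
  have hy' : ∀ j, |(S' j).2| ≤ Cy := fun j => by
    by_cases h : j = i
    · subst h; simpa [hS'] using hyt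
    · simpa [hS', h] using hy j
  have hl' : ∀ j, sqLoss φ u W0 (S' j) ≤ C0 := fun j => by
    by_cases h : j = i
    · subst h; simpa [hS'] using hl0t
    · simpa [hS', h] using hl0 j
  -- distance of iterates
  have hgd : ∀ T : Fin n → Input d × ℝ, (∀ j, ‖(T j).1‖ ≤ Cx) → (∀ j, |(T j).2| ≤ Cy) →
      (∀ j, sqLoss φ u W0 (T j) ≤ C0) →
      ‖gdIter η (empRisk φ u T) W0 t - W0‖ ^ 2 ≤ 2 * η * t * C0 ∧
        empRisk φ u T (gdIter η (empRisk φ u T) W0 t) ≤ C0 := by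
    intro T h1 h2 h3
    have hup := fun W D => (aux_risk hm φ Bφ Bφ' Bφ'' hφ hφ' hBφ hBφ' hBφ'' u hu Cx Cy T h1 h2 ρ hρ hρ0
      (empRisk φ u T) (fun _ => 1 / (n:ℝ)) (fun _ => by positivity)
      (by simp [hn'.ne']) (aux_emp φ u T) W D).1
    have := aux_gd (empRisk φ u T) (gradient (empRisk φ u T)) ρ η hη0 hηρ hup
      (gdIter η (empRisk φ u T) W0) (fun s => rfl) t
    have h0 : empRisk φ u T W0 ≤ C0 := aux_emp_le hn φ u T W0 C0 h3
    have e0 : gdIter η (empRisk φ u T) W0 0 = W0 := rfl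
    rw [e0] at this
    refine ⟨this.1.trans ?_, this.2.trans h0⟩
    have hnn := aux_emp_nonneg φ u T (gdIter η (empRisk φ u T) W0 t)
    calc (t:ℝ) * (2 * η * (empRisk φ u T W0 - empRisk φ u T (gdIter η (empRisk φ u T) W0 t)))
        ≤ t * (2 * η * C0) := by gcongr; linarith
      _ = _ := by ring
  obtain ⟨hw1, hw2⟩ := hgd S hx hy hl0
  obtain ⟨hv1, hv2⟩ := hgd S' hx' hy' hl'
  set w := gdIter η (empRisk φ u S) W0 t
  set v := gdIter η (empRisk φ u S') W0 t
  have hrisk := fun W D => (aux_risk hm φ Bφ Bφ' Bφ'' hφ hφ' hBφ hBφ' hBφ'' u hu Cx Cy S hx hy ρ hρ hρ0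
      (looRisk φ u S i) (fun j => if j = i then 0 else 1 / (n:ℝ))
      (fun j => by split_ifs <;> positivity)
      (by
        calc ∑ j, (if j = i then 0 else 1 / (n:ℝ)) ≤ ∑ j : Fin n, 1 / (n:ℝ) := by
              refine Finset.sum_le_sum fun j _ => ?_
              split_ifs
              · positivity
              · exact le_rfl
          _ ≤ 1 := by simp [hn'.ne']) (aux_loo φ u S i) W D)
  have hup := fun W D => (hrisk W D).1
  set P := looRisk φ u S i
  set G := gradient P
  have hPw : P w ≤ C0 := by
    have := aux_loo_le φ u S i (S i) w
    rw [Function.update_eq_self] at this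
    exact this.trans hw2
  have hPv : P v ≤ C0 := (aux_loo_le φ u S i ztil v).trans hv2
  let R : ℝ := Real.sqrt (2 * η * t * C0)
  have hG : ∀ W, P W ≤ C0 → ‖η • G W‖ ≤ R := fun W hW => by
    refine Real.le_sqrt_of_sq_le ((aux_step P G ρ η hη0 hηρ hup W).trans ?_)
    have := aux_loo_nonneg φ u S i (W - η • G W)
    have h1 : P W - P (W - η • G W) ≤ C0 := by linarith
    calc 2 * η * (P W - P (W - η • G W)) ≤ 2 * η * C0 := by gcongr
      _ = 2 * η * 1 * C0 := by ring
      _ ≤ _ := by gcongr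
  have hwR : ‖w - W0‖ ≤ R := Real.le_sqrt_of_sq_le hw1
  have hvR : ‖v - W0‖ ≤ R := Real.le_sqrt_of_sq_le hv1
  have hR0 : 0 ≤ R := Real.sqrt_nonneg _
  have hΔ : ‖η • (G w - G v)‖ ≤ 2 * R := by
    rw [smul_sub]
    have := norm_sub_le (η • G w) (η • G v)
    linarith [hG w hPw, hG v hPv]
  let r : ℝ := Real.sqrt (2 * C0) + Bφ' * Cx * (3 * R)
  have hr0 : 0 ≤ r := by positivity
  -- residual near initialization
  have hres : ∀ W, ‖W - W0‖ ≤ 3 * R → ∀ j, |nnet φ u W (S j).1 - (S j).2| ≤ r := by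
    intro W hW j
    have h1 : |nnet φ u W0 (S j).1 - (S j).2| ≤ Real.sqrt (2 * C0) := by
      refine Real.abs_le_sqrt ?_
      have := hl0 j
      unfold sqLoss at this
      linarith
    have h2 := aux_nnet_lip hm φ Bφ' hφ hBφ' u hu Cx (S j).1 (hx j) W0 (W - W0)
    rw [add_sub_cancel] at h2
    have h3 : Bφ' * Cx * ‖W - W0‖ ≤ Bφ' * Cx * (3 * R) := by gcongr
    have h4 := abs_add_le (nnet φ u W (S j).1 - nnet φ u W0 (S j).1) (nnet φ u W0 (S j).1 - (S j).2)
    rw [sub_add_sub_cancel] at h4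
    simp only [r]
    linarith
  have hseg : ∀ A B : Param d m, ‖A - W0‖ ≤ 3 * R → ‖B - W0‖ ≤ 3 * R → ∀ a ∈ Set.Icc (0:ℝ) 1,
      ‖A + a • (B - A) - W0‖ ≤ 3 * R := by
    intro A B hA hB a ha
    have hconv := convex_closedBall W0 (3 * R)
    have hA' : A ∈ Metric.closedBall W0 (3 * R) := by rwa [mem_closedBall_iff_norm]
    have hB' : B ∈ Metric.closedBall W0 (3 * R) := by rwa [mem_closedBall_iff_norm]
    have := hconv.add_smul_sub_mem hA' hB' ha
    rwa [mem_closedBall_iff_norm] at this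
  have hεr : Cx ^ 2 * Bφ'' * r / Real.sqrt m ≤ ε := by
    have e1 : Real.sqrt (2 * C0) = Real.sqrt 2 * Real.sqrt C0 := Real.sqrt_mul (by norm_num) _
    have e2 : R = Real.sqrt 2 * Real.sqrt (η * t) * Real.sqrt C0 := by
      simp only [R]
      rw [Real.sqrt_mul (by positivity), mul_assoc 2, Real.sqrt_mul (by norm_num)]
    have hs2 : Real.sqrt 2 ≤ 3 / 2 := Real.sqrt_le_iff.2 (by norm_num)
    have : r ≤ 2 * Real.sqrt C0 * (4 * Bφ' * Cx * Real.sqrt (η * t) + Real.sqrt 2) := by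
      simp only [r]
      rw [e1, e2]
      have a1 : 0 ≤ Real.sqrt 2 * Real.sqrt C0 := by positivity
      have a2 : 0 ≤ Bφ' * Cx * Real.sqrt (η * t) * Real.sqrt C0 := by positivity
      nlinarith [mul_le_mul_of_nonneg_left hs2 a2]
    rw [hεdef]
    calc Cx ^ 2 * Bφ'' * r / Real.sqrt m ≤ Cx ^ 2 * Bφ'' *
          (2 * Real.sqrt C0 * (4 * Bφ' * Cx * Real.sqrt (η * t) + Real.sqrt 2)) / Real.sqrt m := by
          gcongr
      _ = _ := by ring
  have hlow : ∀ A D : Param d m, ‖A - W0‖ ≤ 3 * R → ‖A + D - W0‖ ≤ 3 * R →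
      P A + inner ℝ (G A) D - ε / 2 * ‖D‖ ^ 2 ≤ P (A + D) := by
    intro A D hA hB
    have := (hrisk A D).2 r hr0 (fun j a ha => hres _ (by
      have := hseg A (A + D) hA hB a ha
      rwa [add_sub_cancel_left] at this) j)
    have h2 : (Cx ^ 2 * Bφ'' * r / Real.sqrt m) / 2 * ‖D‖ ^ 2 ≤ ε / 2 * ‖D‖ ^ 2 := by gcongr
    linarith
  refine aux_cocoer P G ρ ε η w v hup (hlow _ _ (by linarith) ?_) (hlow _ _ (by linarith) ?_)
  · have : v + (w - v - η • (G w - G v)) - W0 = (w - W0) - η • (G w - G v) := by abel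
    rw [this]
    have := norm_sub_le (w - W0) (η • (G w - G v))
    linarith
  · have : w + -(w - v - η • (G w - G v)) - W0 = (v - W0) + η • (G w - G v) := by abel
    rw [this]
    have := norm_add_le (v - W0) (η • (G w - G v))
    linarith
end

section
/- (Curvature along the stability interpolation) Fix s ≥ 0 and i ∈ {1,…,n}, and for α ∈ [0,1] set W(α) = W_s^{(i)} + α(W_s − W_s^{(i)} − η(∇L_{S∖i}(W_s) − ∇L_{S∖i}(W_s^{(i)}))) and W̃(α) = W_s + α(W_s^{(i)} − W_s − η(∇L_{S∖i}(W_s^{(i)}) − ∇L_{S∖i}(W_s))). If η ≤ 1/(2ρ), then for every α ∈ [0,1], both λ_min(∇²L_{S∖i}(W(α))) ≥ −ε̃ and λ_min(∇²L_{S∖i}(W̃(α))) ≥ −ε̃, where ε̃ = (C_x² B_{φ''}/√m)(4 B_{φ'} C_x √(ηs)(√(L_S(W_0)) + √(L_{S^{(i)}}(W_0))) + √(2 L_{S^{(i)}}(W_0)) + √(2 L_S(W_0))). -/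
open MeasureTheory Finset
open scoped BigOperators

namespace Aux
variable {d m n : ℕ}

noncomputable def aL (x : Input d) (k : Fin m) : Param d m →L[ℝ] ℝ :=
  ∑ j : Fin d, x j • (EuclideanSpace.proj (k, j) : Param d m →L[ℝ] ℝ)

lemma aL_apply (x : Input d) (k : Fin m) (W : Param d m) :
    aL x k W = ∑ j : Fin d, W (k, j) * x j := by
  simp [aL, mul_comm]

lemma aL_sq (x : Input d) (v : Param d m) :
    ∑ k, (aL x k v) ^ 2 ≤ (‖x‖ * ‖v‖) ^ 2 := by
  rw [mul_pow, EuclideanSpace.norm_sq_eq, EuclideanSpace.norm_sq_eq, Fintype.sum_prod_type,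
    mul_comm, Finset.sum_mul]
  refine Finset.sum_le_sum fun k _ => ?_
  rw [aL_apply]
  simpa using Finset.sum_mul_sq_le_sq_mul_sq Finset.univ (fun j => v (k, j)) (fun j => x j)

noncomputable def gD (φ : ℝ → ℝ) (u : Fin m → ℝ) (x : Input d) (W : Param d m) :
    Param d m →L[ℝ] ℝ :=
  ∑ k, (u k * deriv φ (aL x k W)) • aL x k

noncomputable def gDD (φ : ℝ → ℝ) (u : Fin m → ℝ) (x : Input d) (W : Param d m) :
    Param d m →L[ℝ] (Param d m →L[ℝ] ℝ) :=
  ∑ k, ((u k * deriv (deriv φ) (aL x k W)) • aL x k).smulRight (aL x k)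

lemma gD_apply (φ : ℝ → ℝ) (u : Fin m → ℝ) (x : Input d) (W v : Param d m) :
    gD φ u x W v = ∑ k, (u k * deriv φ (aL x k W)) * aL x k v := by
  simp [gD]

lemma gDD_apply (φ : ℝ → ℝ) (u : Fin m → ℝ) (x : Input d) (W v w : Param d m) :
    gDD φ u x W v w = ∑ k, (u k * deriv (deriv φ) (aL x k W)) * (aL x k v * aL x k w) := by
  simp [gDD, mul_assoc]

lemma nnet_eq (φ : ℝ → ℝ) (u : Fin m → ℝ) (W : Param d m) (x : Input d) :
    nnet φ u W x = ∑ k, u k * φ (aL x k W) := by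
  simp [nnet, aL_apply]

lemma hasFDerivAt_nnet {φ : ℝ → ℝ} (hφ : Differentiable ℝ φ) (u : Fin m → ℝ) (x : Input d)
    (W : Param d m) : HasFDerivAt (fun W => nnet φ u W x) (gD φ u x W) W := by
  simp only [nnet_eq, gD]
  refine HasFDerivAt.fun_sum fun k _ => ?_
  have h := ((hφ (aL x k W)).hasDerivAt.comp_hasFDerivAt W (aL x k).hasFDerivAt).const_mul (u k)
  simpa [smul_smul] using h

lemma hasFDerivAt_gD {φ : ℝ → ℝ} (hφ' : Differentiable ℝ (deriv φ)) (u : Fin m → ℝ) (x : Input d)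
    (W : Param d m) : HasFDerivAt (fun W => gD φ u x W) (gDD φ u x W) W := by
  simp only [gD, gDD]
  refine HasFDerivAt.fun_sum fun k _ => ?_
  have h := ((hφ' (aL x k W)).hasDerivAt.comp_hasFDerivAt W (aL x k).hasFDerivAt).const_mul (u k)
  have h2 := h.smul_const (aL x k)
  simpa [smul_smul] using h2

noncomputable def lD (φ : ℝ → ℝ) (u : Fin m → ℝ) (z : Input d × ℝ) (W : Param d m) :
    Param d m →L[ℝ] ℝ := (nnet φ u W z.1 - z.2) • gD φ u z.1 W

noncomputable def lDD (φ : ℝ → ℝ) (u : Fin m → ℝ) (z : Input d × ℝ) (W : Param d m) :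
    Param d m →L[ℝ] (Param d m →L[ℝ] ℝ) :=
  (nnet φ u W z.1 - z.2) • gDD φ u z.1 W + (gD φ u z.1 W).smulRight (gD φ u z.1 W)

lemma hasFDerivAt_l {φ : ℝ → ℝ} (hφ : Differentiable ℝ φ) (u : Fin m → ℝ) (z : Input d × ℝ)
    (W : Param d m) : HasFDerivAt (fun W => sqLoss φ u W z) (lD φ u z W) W := by
  have h := (((hasFDerivAt_nnet hφ u z.1 W).sub_const z.2).pow 2).mul_const (1/2 : ℝ)
  unfold sqLoss lD
  refine (h.congr_fderiv ?_).congr_of_eventuallyEq (Filter.Eventually.of_forall fun W => ?_)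
  · ext v; simp; ring
  · simp; ring

lemma hasFDerivAt_lD {φ : ℝ → ℝ} (hφ : Differentiable ℝ φ) (hφ' : Differentiable ℝ (deriv φ))
    (u : Fin m → ℝ) (z : Input d × ℝ)
    (W : Param d m) : HasFDerivAt (fun W => lD φ u z W) (lDD φ u z W) W := by
  exact ((hasFDerivAt_nnet hφ u z.1 W).sub_const z.2).smul (hasFDerivAt_gD hφ' u z.1 W)

noncomputable def wR (φ : ℝ → ℝ) (u : Fin m → ℝ) (c : Fin n → ℝ) (S : Fin n → Input d × ℝ)
    (W : Param d m) : ℝ := ∑ j, c j * sqLoss φ u W (S j)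

noncomputable def wD (φ : ℝ → ℝ) (u : Fin m → ℝ) (c : Fin n → ℝ) (S : Fin n → Input d × ℝ)
    (W : Param d m) : Param d m →L[ℝ] ℝ := ∑ j, c j • lD φ u (S j) W

noncomputable def wDD (φ : ℝ → ℝ) (u : Fin m → ℝ) (c : Fin n → ℝ) (S : Fin n → Input d × ℝ)
    (W : Param d m) : Param d m →L[ℝ] (Param d m →L[ℝ] ℝ) := ∑ j, c j • lDD φ u (S j) W

lemma hasFDerivAt_w {φ : ℝ → ℝ} (hφ : Differentiable ℝ φ) (u : Fin m → ℝ) (c : Fin n → ℝ)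
    (S : Fin n → Input d × ℝ) (W : Param d m) :
    HasFDerivAt (wR φ u c S) (wD φ u c S W) W :=
  HasFDerivAt.fun_sum fun j _ => (hasFDerivAt_l hφ u (S j) W).const_mul (c j)

lemma hasFDerivAt_wD {φ : ℝ → ℝ} (hφ : Differentiable ℝ φ) (hφ' : Differentiable ℝ (deriv φ))
    (u : Fin m → ℝ) (c : Fin n → ℝ) (S : Fin n → Input d × ℝ) (W : Param d m) :
    HasFDerivAt (wD φ u c S) (wDD φ u c S W) W :=
  HasFDerivAt.fun_sum fun j _ => (hasFDerivAt_lD hφ hφ' u (S j) W).const_smul (c j)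

lemma iter_two {φ : ℝ → ℝ} (hφ : Differentiable ℝ φ) (hφ' : Differentiable ℝ (deriv φ))
    (u : Fin m → ℝ) (c : Fin n → ℝ) (S : Fin n → Input d × ℝ) (W v : Param d m) :
    iteratedFDeriv ℝ 2 (wR φ u c S) W ![v, v] = wDD φ u c S W v v := by
  rw [iteratedFDeriv_two_apply]
  have : fderiv ℝ (wR φ u c S) = wD φ u c S := funext fun W => (hasFDerivAt_w hφ u c S W).fderiv
  rw [this, (hasFDerivAt_wD hφ hφ' u c S W).fderiv]
  simp

lemma emp_eq (φ : ℝ → ℝ) (u : Fin m → ℝ) (S : Fin n → Input d × ℝ) :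
    empRisk φ u S = wR φ u (fun _ => 1 / (n : ℝ)) S := by
  funext W
  simp only [empRisk, wR, ← Finset.mul_sum]; ring

lemma loo_eq (φ : ℝ → ℝ) (u : Fin m → ℝ) (S : Fin n → Input d × ℝ) (i : Fin n) :
    looRisk φ u S i = wR φ u (fun j => if j = i then 0 else 1 / (n : ℝ)) S := by
  funext W
  rw [looRisk, emp_eq]
  simp only [wR]
  rw [sub_eq_iff_eq_add, ← Finset.add_sum_erase _ _ (Finset.mem_univ i),
    ← Finset.add_sum_erase (a := i) _ (fun j => (if j = i then 0 else 1 / (n : ℝ)) * _) (Finset.mem_univ i)]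
  rw [Finset.sum_congr rfl (g := fun j => (if j = i then 0 else 1 / (n : ℝ)) * sqLoss φ u W (S j))]
  · simp; ring
  · intro j hj
    simp [Finset.ne_of_mem_erase hj]

/-! bounds -/

lemma abs_u {u : Fin m → ℝ} (hu : ∀ k, u k = 1 / Real.sqrt m ∨ u k = -(1 / Real.sqrt m))
    (k : Fin m) : |u k| = 1 / Real.sqrt m := by
  have : 0 ≤ 1 / Real.sqrt m := by positivity
  rcases hu k with h | h <;> rw [h]
  · exact abs_of_nonneg this
  · rw [abs_neg, abs_of_nonneg this]

lemma gD_bound {φ : ℝ → ℝ} {B : ℝ} (hm : 1 ≤ m) (hB : ∀ s, |deriv φ s| ≤ B) {u : Fin m → ℝ}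
    (hu : ∀ k, u k = 1 / Real.sqrt m ∨ u k = -(1 / Real.sqrt m)) {Cx : ℝ} (x : Input d)
    (hx : ‖x‖ ≤ Cx) (W v : Param d m) : |gD φ u x W v| ≤ B * Cx * ‖v‖ := by
  have hB0 : 0 ≤ B := (abs_nonneg _).trans (hB 0)
  have hm0 : (0 : ℝ) < m := by exact_mod_cast hm
  have hC : 0 ≤ Cx := (norm_nonneg _).trans hx
  have h1 : ∑ k, (u k * deriv φ (aL x k W)) ^ 2 ≤ B ^ 2 := by
    calc ∑ k, (u k * deriv φ (aL x k W)) ^ 2 ≤ ∑ k : Fin m, (1 / (m : ℝ)) * B ^ 2 := by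
          refine Finset.sum_le_sum fun k _ => ?_
          rw [mul_pow, ← sq_abs (u k), abs_u hu, ← sq_abs (deriv φ _), div_pow,
            Real.sq_sqrt hm0.le, one_pow]
          gcongr
          exact hB _
      _ = B ^ 2 := by simp; field_simp
  have h2 : (gD φ u x W v) ^ 2 ≤ (B * Cx * ‖v‖) ^ 2 := by
    rw [gD_apply]
    refine (Finset.sum_mul_sq_le_sq_mul_sq _ _ _).trans ?_
    rw [mul_assoc, mul_pow]
    refine mul_le_mul h1 ((aL_sq x v).trans ?_) (Finset.sum_nonneg fun _ _ => sq_nonneg _)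
      (sq_nonneg _)
    gcongr
  exact abs_le_of_sq_le_sq h2 (by positivity)

lemma gDD_bound {φ : ℝ → ℝ} {B : ℝ} (hB : ∀ s, |deriv (deriv φ) s| ≤ B)
    {u : Fin m → ℝ}
    (hu : ∀ k, u k = 1 / Real.sqrt m ∨ u k = -(1 / Real.sqrt m)) {Cx : ℝ} (x : Input d)
    (hx : ‖x‖ ≤ Cx) (W v w : Param d m) :
    |gDD φ u x W v w| ≤ Cx ^ 2 * B / Real.sqrt m * (‖v‖ * ‖w‖) := by
  have hB0 : 0 ≤ B := (abs_nonneg _).trans (hB 0)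
  have hC : 0 ≤ Cx := (norm_nonneg _).trans hx
  have h1 : ∑ k, |aL x k v| * |aL x k w| ≤ (Cx * ‖v‖) * (Cx * ‖w‖) := by
    have h2 : (∑ k, |aL x k v| * |aL x k w|) ^ 2 ≤ ((Cx * ‖v‖) * (Cx * ‖w‖)) ^ 2 := by
      refine (Finset.sum_mul_sq_le_sq_mul_sq _ _ _).trans ?_
      simp only [sq_abs]
      rw [mul_pow]
      refine mul_le_mul ((aL_sq x v).trans ?_) ((aL_sq x w).trans ?_)
        (Finset.sum_nonneg fun _ _ => sq_nonneg _) (sq_nonneg _) <;> gcongr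
    exact (abs_le.1 (abs_le_of_sq_le_sq h2 (by positivity))).2
  rw [gDD_apply]
  calc |∑ k, (u k * deriv (deriv φ) (aL x k W)) * (aL x k v * aL x k w)|
      ≤ ∑ k, |(u k * deriv (deriv φ) (aL x k W)) * (aL x k v * aL x k w)| :=
        Finset.abs_sum_le_sum_abs _ _
    _ ≤ ∑ k, (1 / Real.sqrt m * B) * (|aL x k v| * |aL x k w|) := by
        refine Finset.sum_le_sum fun k _ => ?_
        rw [abs_mul, abs_mul, abs_mul, abs_u hu]
        gcongr
        exact hB _
    _ ≤ (1 / Real.sqrt m * B) * ((Cx * ‖v‖) * (Cx * ‖w‖)) := by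
        rw [← Finset.mul_sum]; gcongr
    _ = _ := by ring

lemma nnet_bound {φ : ℝ → ℝ} {B : ℝ} (hB : ∀ s, |φ s| ≤ B) {u : Fin m → ℝ}
    (hu : ∀ k, u k = 1 / Real.sqrt m ∨ u k = -(1 / Real.sqrt m)) (x : Input d)
    (W : Param d m) : |nnet φ u W x| ≤ Real.sqrt m * B := by
  rw [nnet_eq]
  calc _ ≤ ∑ k, |u k * φ (aL x k W)| := Finset.abs_sum_le_sum_abs _ _
    _ ≤ ∑ k : Fin m, 1 / Real.sqrt m * B := by
        refine Finset.sum_le_sum fun k _ => ?_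
        rw [abs_mul, abs_u hu]
        gcongr
        exact hB _
    _ = m / Real.sqrt m * B := by
        rw [Finset.sum_const, Finset.card_univ, Fintype.card_fin, nsmul_eq_mul]; ring
    _ = _ := by rw [Real.div_sqrt]

lemma lDD_bound {φ : ℝ → ℝ} {B B' B'' : ℝ} (hm : 1 ≤ m) (hB : ∀ s, |φ s| ≤ B)
    (hB' : ∀ s, |deriv φ s| ≤ B')
    (hB'' : ∀ s, |deriv (deriv φ) s| ≤ B'') {u : Fin m → ℝ}
    (hu : ∀ k, u k = 1 / Real.sqrt m ∨ u k = -(1 / Real.sqrt m)) {Cx Cy : ℝ} (z : Input d × ℝ)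
    (hx : ‖z.1‖ ≤ Cx) (hy : |z.2| ≤ Cy) (W v w : Param d m) :
    |lDD φ u z W v w| ≤
      Cx ^ 2 * (B' ^ 2 + B'' * B + B'' * Cy / Real.sqrt m) * (‖v‖ * ‖w‖) := by
  have hC : 0 ≤ Cx := (norm_nonneg _).trans hx
  have hB0 : 0 ≤ B := (abs_nonneg _).trans (hB 0)
  have hB0' : 0 ≤ B' := (abs_nonneg _).trans (hB' 0)
  have hB0'' : 0 ≤ B'' := (abs_nonneg _).trans (hB'' 0)
  have hCy : 0 ≤ Cy := (abs_nonneg _).trans hy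
  have hm0 : (0 : ℝ) < m := by exact_mod_cast hm
  have hs : 0 < Real.sqrt m := Real.sqrt_pos.2 hm0
  have e : lDD φ u z W v w = (nnet φ u W z.1 - z.2) * gDD φ u z.1 W v w
      + gD φ u z.1 W v * gD φ u z.1 W w := by simp [lDD]
  rw [e]
  calc _ ≤ |nnet φ u W z.1 - z.2| * |gDD φ u z.1 W v w|
      + |gD φ u z.1 W v| * |gD φ u z.1 W w| := by
        rw [← abs_mul, ← abs_mul]; exact abs_add_le _ _
    _ ≤ (Real.sqrt m * B + Cy) * (Cx ^ 2 * B'' / Real.sqrt m * (‖v‖ * ‖w‖))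
      + (B' * Cx * ‖v‖) * (B' * Cx * ‖w‖) := by
        gcongr
        · exact (abs_sub _ _).trans (add_le_add (nnet_bound hB hu _ _) hy)
        · exact gDD_bound hB'' hu _ hx _ _ _
        · exact gD_bound hm hB' hu _ hx _ _
        · exact gD_bound hm hB' hu _ hx _ _
    _ = _ := by field_simp; ring

lemma wDD_bound {φ : ℝ → ℝ} {B B' B'' : ℝ} (hm : 1 ≤ m) (hB : ∀ s, |φ s| ≤ B)
    (hB' : ∀ s, |deriv φ s| ≤ B')
    (hB'' : ∀ s, |deriv (deriv φ) s| ≤ B'') {u : Fin m → ℝ}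
    (hu : ∀ k, u k = 1 / Real.sqrt m ∨ u k = -(1 / Real.sqrt m)) {Cx Cy : ℝ}
    (S : Fin n → Input d × ℝ) (c : Fin n → ℝ) (hc : ∀ j, 0 ≤ c j) (hc1 : ∑ j, c j ≤ 1)
    (hx : ∀ j, ‖(S j).1‖ ≤ Cx) (hy : ∀ j, |(S j).2| ≤ Cy) {ρ : ℝ} (hρ0 : 0 ≤ ρ)
    (hρ : ρ = Cx ^ 2 * (B' ^ 2 + B'' * B + B'' * Cy / Real.sqrt m)) (W : Param d m) :
    ‖wDD φ u c S W‖ ≤ ρ := by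
  refine ContinuousLinearMap.opNorm_le_bound₂ _ hρ0 fun v w => ?_
  have e : wDD φ u c S W v w = ∑ j, c j * lDD φ u (S j) W v w := by simp [wDD]
  rw [e, Real.norm_eq_abs, mul_assoc]
  calc _ ≤ ∑ j, |c j * lDD φ u (S j) W v w| := Finset.abs_sum_le_sum_abs _ _
    _ ≤ ∑ j, c j * (ρ * (‖v‖ * ‖w‖)) := by
        refine Finset.sum_le_sum fun j _ => ?_
        rw [abs_mul, abs_of_nonneg (hc j), hρ]
        exact mul_le_mul_of_nonneg_left (lDD_bound hm hB hB' hB'' hu _ (hx j) (hy j) _ _ _) (hc j)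
    _ ≤ 1 * (ρ * (‖v‖ * ‖w‖)) := by rw [← Finset.sum_mul]; gcongr
    _ = _ := one_mul _

lemma wDD_lower {φ : ℝ → ℝ} {B'' : ℝ}
    (hB'' : ∀ s, |deriv (deriv φ) s| ≤ B'') {u : Fin m → ℝ}
    (hu : ∀ k, u k = 1 / Real.sqrt m ∨ u k = -(1 / Real.sqrt m)) {Cx : ℝ}
    (S : Fin n → Input d × ℝ) (c : Fin n → ℝ) (hc : ∀ j, 0 ≤ c j)
    (hx : ∀ j, ‖(S j).1‖ ≤ Cx) (W v : Param d m) :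
    -(Cx ^ 2 * B'' / Real.sqrt m * ∑ j, c j * |nnet φ u W (S j).1 - (S j).2|) * ‖v‖ ^ 2
      ≤ wDD φ u c S W v v := by
  have e : wDD φ u c S W v v = ∑ j, c j * lDD φ u (S j) W v v := by simp [wDD]
  rw [e, Finset.mul_sum, neg_mul, Finset.sum_mul, ← Finset.sum_neg_distrib]
  refine Finset.sum_le_sum fun j _ => ?_
  have e : lDD φ u (S j) W v v = (nnet φ u W (S j).1 - (S j).2) * gDD φ u (S j).1 W v v
      + gD φ u (S j).1 W v * gD φ u (S j).1 W v := by simp [lDD]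
  have h1 : |(nnet φ u W (S j).1 - (S j).2) * gDD φ u (S j).1 W v v| ≤
      |nnet φ u W (S j).1 - (S j).2| * (Cx ^ 2 * B'' / Real.sqrt m * (‖v‖ * ‖v‖)) := by
    rw [abs_mul]
    exact mul_le_mul_of_nonneg_left (gDD_bound hB'' hu _ (hx j) _ _ _) (abs_nonneg _)
  have h2 := (abs_le.1 h1).1
  have h3 := mul_self_nonneg (gD φ u (S j).1 W v)
  have h4 : -(|nnet φ u W (S j).1 - (S j).2| * (Cx ^ 2 * B'' / Real.sqrt m * (‖v‖ * ‖v‖)))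
    ≤ lDD φ u (S j) W v v := by rw [e]; linarith
  have := mul_le_mul_of_nonneg_left h4 (hc j)
  refine le_trans (le_of_eq ?_) this
  ring

lemma nnet_lip {φ : ℝ → ℝ} {B : ℝ} (hm : 1 ≤ m) (hφ : Differentiable ℝ φ)
    (hB : ∀ s, |deriv φ s| ≤ B) {u : Fin m → ℝ}
    (hu : ∀ k, u k = 1 / Real.sqrt m ∨ u k = -(1 / Real.sqrt m)) {Cx : ℝ} (x : Input d)
    (hx : ‖x‖ ≤ Cx) (W V : Param d m) :
    |nnet φ u W x - nnet φ u V x| ≤ B * Cx * ‖W - V‖ := by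
  have hB0 : 0 ≤ B := (abs_nonneg _).trans (hB 0)
  have hC : 0 ≤ Cx := (norm_nonneg _).trans hx
  exact Convex.norm_image_sub_le_of_norm_hasFDerivWithin_le
    (f := fun W => nnet φ u W x) (s := Set.univ)
    (fun W _ => (hasFDerivAt_nnet hφ u x W).hasFDerivWithinAt)
    (fun W _ => ContinuousLinearMap.opNorm_le_bound _ (by positivity)
      fun v => gD_bound hm hB hu x hx W v) convex_univ (Set.mem_univ V) (Set.mem_univ W)

lemma wD_lip {φ : ℝ → ℝ} (hφ : Differentiable ℝ φ) (hφ' : Differentiable ℝ (deriv φ))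
    {u : Fin m → ℝ} {S : Fin n → Input d × ℝ} {c : Fin n → ℝ} {ρ : ℝ}
    (h : ∀ W, ‖wDD φ u c S W‖ ≤ ρ) (W V : Param d m) :
    ‖wD φ u c S W - wD φ u c S V‖ ≤ ρ * ‖W - V‖ :=
  Convex.norm_image_sub_le_of_norm_hasFDerivWithin_le
    (f := wD φ u c S) (s := Set.univ)
    (fun W _ => (hasFDerivAt_wD hφ hφ' u c S W).hasFDerivWithinAt)
    (fun W _ => h W) convex_univ (Set.mem_univ V) (Set.mem_univ W)

lemma grad_eq {φ : ℝ → ℝ} (hφ : Differentiable ℝ φ)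
    (u : Fin m → ℝ) (S : Fin n → Input d × ℝ) (c : Fin n → ℝ) (W : Param d m) :
    gradient (wR φ u c S) W = (InnerProductSpace.toDual ℝ (Param d m)).symm (wD φ u c S W) := by
  rw [gradient, (hasFDerivAt_w hφ u c S W).fderiv]

lemma wR_nonneg (φ : ℝ → ℝ) 
    (u : Fin m → ℝ) (S : Fin n → Input d × ℝ) (c : Fin n → ℝ) (hc : ∀ j, 0 ≤ c j) (W : Param d m) :
    0 ≤ wR φ u c S W := 
  Finset.sum_nonneg fun j _ => mul_nonneg (hc j) (by unfold sqLoss; positivity)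

lemma descent {φ : ℝ → ℝ} (hφ : Differentiable ℝ φ) (hφ' : Differentiable ℝ (deriv φ))
    {u : Fin m → ℝ} {S : Fin n → Input d × ℝ} {c : Fin n → ℝ} {ρ : ℝ}
    (h : ∀ W, ‖wDD φ u c S W‖ ≤ ρ) {η : ℝ} (hη0 : 0 < η) (hη : η * ρ ≤ 1 / 2) (W : Param d m) :
    wR φ u c S (W - η • gradient (wR φ u c S) W) ≤
      wR φ u c S W - η / 2 * ‖gradient (wR φ u c S) W‖ ^ 2 := by
  set g := gradient (wR φ u c S) W with hg
  have hg2 : wD φ u c S W g = ‖g‖ ^ 2 := by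
    rw [hg, grad_eq hφ, ← real_inner_self_eq_norm_sq, InnerProductSpace.toDual_symm_apply]
  obtain ⟨ξ, hξ, he⟩ := domain_mvt (f := wR φ u c S) (s := Set.univ) (x := W) (y := W - η • g)
    (fun x _ => (hasFDerivAt_w hφ u c S x).hasFDerivWithinAt) convex_univ (Set.mem_univ _)
    (Set.mem_univ _)
  have hξn : ‖ξ - W‖ ≤ η * ‖g‖ := by
    have := norm_sub_le_of_mem_segment hξ
    simpa [norm_smul, abs_of_pos hη0] using this
  have hρ0 : 0 ≤ ρ := le_trans (norm_nonneg (wDD φ u c S W)) (h W)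
  have e : W - η • g - W = -(η • g) := by abel
  rw [e, map_neg, map_smul, smul_eq_mul] at he
  have hb : |(wD φ u c S ξ - wD φ u c S W) g| ≤ ρ * (η * ‖g‖) * ‖g‖ := by
    refine ((wD φ u c S ξ - wD φ u c S W).le_opNorm g).trans ?_
    gcongr
    refine (wD_lip hφ hφ' h _ _).trans ?_
    gcongr
  have hb1 := (abs_le.1 hb).1
  rw [ContinuousLinearMap.sub_apply, hg2] at hb1
  have hb2 : ρ * (η * ‖g‖) * ‖g‖ ≤ 1 / 2 * ‖g‖ ^ 2 := by
    have := mul_le_mul_of_nonneg_right hη (sq_nonneg ‖g‖)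
    nlinarith
  have hb3 : 1 / 2 * ‖g‖ ^ 2 ≤ wD φ u c S ξ g := by linarith
  have := mul_le_mul_of_nonneg_left hb3 hη0.le
  linarith

lemma gd_bounds {φ : ℝ → ℝ} (hφ : Differentiable ℝ φ) (hφ' : Differentiable ℝ (deriv φ))
    {u : Fin m → ℝ} {S : Fin n → Input d × ℝ} {c : Fin n → ℝ} (hc : ∀ j, 0 ≤ c j) {ρ : ℝ}
    (h : ∀ W, ‖wDD φ u c S W‖ ≤ ρ) {η : ℝ} (hη0 : 0 < η) (hη : η * ρ ≤ 1 / 2) (W0 : Param d m)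
    (s : ℕ) :
    wR φ u c S (gdIter η (wR φ u c S) W0 s) ≤ wR φ u c S W0 ∧
    ‖gdIter η (wR φ u c S) W0 s - W0‖ ≤ Real.sqrt 2 * Real.sqrt (η * s) * Real.sqrt (wR φ u c S W0) := by
  set L := wR φ u c S with hL
  have key : ∀ t, L (gdIter η L W0 t) +
      ∑ r ∈ Finset.range t, η / 2 * ‖gradient L (gdIter η L W0 r)‖ ^ 2 ≤ L W0 := by
    intro t
    induction t with
    | zero => simp [gdIter]
    | succ t ih =>
      rw [Finset.sum_range_succ]
      have := descent hφ hφ' h hη0 hη (gdIter η L W0 t)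
      rw [← hL] at this
      simp only [gdIter]
      linarith
  have hsum0 : 0 ≤ ∑ r ∈ Finset.range s, η / 2 * ‖gradient L (gdIter η L W0 r)‖ ^ 2 :=
    Finset.sum_nonneg fun _ _ => by positivity
  refine ⟨by linarith [key s], ?_⟩
  have hd : ∀ t, ‖gdIter η L W0 t - W0‖ ≤
      ∑ r ∈ Finset.range t, η * ‖gradient L (gdIter η L W0 r)‖ := by
    intro t
    induction t with
    | zero => simp [gdIter]
    | succ t ih =>
      rw [Finset.sum_range_succ]
      simp only [gdIter]
      have e : gdIter η L W0 t - η • gradient L (gdIter η L W0 t) - W0 =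
        (gdIter η L W0 t - W0) - η • gradient L (gdIter η L W0 t) := by abel
      rw [e]
      refine (norm_sub_le _ _).trans ?_
      rw [norm_smul, Real.norm_eq_abs, abs_of_pos hη0]
      linarith
  have hL0 : 0 ≤ L (gdIter η L W0 s) := wR_nonneg φ u S c hc _
  have hLW : 0 ≤ L W0 := wR_nonneg φ u S c hc _
  refine (hd s).trans ?_
  rw [← Real.sqrt_mul (by norm_num), ← Real.sqrt_mul (by positivity)]
  refine Real.le_sqrt_of_sq_le ?_
  have hcs := sq_sum_le_card_mul_sum_sq (s := Finset.range s)
    (f := fun r => η * ‖gradient L (gdIter η L W0 r)‖)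
  rw [Finset.card_range] at hcs
  refine hcs.trans ?_
  have : ∑ r ∈ Finset.range s, (η * ‖gradient L (gdIter η L W0 r)‖) ^ 2 =
    2 * η * ∑ r ∈ Finset.range s, η / 2 * ‖gradient L (gdIter η L W0 r)‖ ^ 2 := by
    rw [Finset.mul_sum]; refine Finset.sum_congr rfl fun r _ => by ring
  rw [this]
  have hk := key s
  calc _ ≤ (s : ℝ) * (2 * η * L W0) := by gcongr; linarith
    _ = _ := by ring

/-- weighted mean of residuals -/
lemma resid {φ : ℝ → ℝ} {u : Fin m → ℝ} {S : Fin n → Input d × ℝ} {c : Fin n → ℝ}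
    (hc : ∀ j, 0 ≤ c j) (hc1 : ∑ j, c j ≤ 1) (W : Param d m) :
    ∑ j, c j * |nnet φ u W (S j).1 - (S j).2| ≤ Real.sqrt (2 * wR φ u c S W) := by
  refine Real.le_sqrt_of_sq_le ?_
  have h := Finset.sum_mul_sq_le_sq_mul_sq Finset.univ (fun j => Real.sqrt (c j))
    (fun j => Real.sqrt (c j) * |nnet φ u W (S j).1 - (S j).2|)
  have e1 : ∀ j, Real.sqrt (c j) * (Real.sqrt (c j) * |nnet φ u W (S j).1 - (S j).2|) =
    c j * |nnet φ u W (S j).1 - (S j).2| := fun j => by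
      rw [← mul_assoc, Real.mul_self_sqrt (hc j)]
  have e2 : ∀ j, Real.sqrt (c j) ^ 2 = c j := fun j => Real.sq_sqrt (hc j)
  simp only [e1, mul_pow, e2, sq_abs] at h
  have e3 : 2 * wR φ u c S W = ∑ j, c j * (nnet φ u W (S j).1 - (S j).2) ^ 2 := by
    rw [wR, Finset.mul_sum]; refine Finset.sum_congr rfl fun j _ => by unfold sqLoss; ring
  rw [e3]
  refine h.trans (mul_le_of_le_one_left ?_ hc1)
  exact Finset.sum_nonneg fun j _ => mul_nonneg (hc j) (sq_nonneg _)

/-- The core estimate from one base point `A`. -/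
lemma core {φ : ℝ → ℝ} {B' B'' : ℝ} (hm : 1 ≤ m) 
    (hφ : Differentiable ℝ φ) (hφ' : Differentiable ℝ (deriv φ))
    (hB' : ∀ s, |deriv φ s| ≤ B')
    (hB'' : ∀ s, |deriv (deriv φ) s| ≤ B'') {u : Fin m → ℝ}
    (hu : ∀ k, u k = 1 / Real.sqrt m ∨ u k = -(1 / Real.sqrt m)) {Cx : ℝ} (hCx : 0 < Cx)
    (S : Fin n → Input d × ℝ) (c : Fin n → ℝ) (hc : ∀ j, 0 ≤ c j) (hc1 : ∑ j, c j ≤ 1)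
    (hx : ∀ j, ‖(S j).1‖ ≤ Cx) {ρ η : ℝ} (hρ : ∀ W, ‖wDD φ u c S W‖ ≤ ρ)
    (hη0 : 0 < η) (hη : η * ρ ≤ 1 / 2) (A V W0 : Param d m) {τ p q r r' εt : ℝ}
    (hτ : 0 ≤ τ) (hp : 0 ≤ p) (hq : 0 ≤ q)
    (hA : ‖A - W0‖ ≤ Real.sqrt 2 * τ * p) (hV : ‖V - W0‖ ≤ Real.sqrt 2 * τ * q)
    (hr : Real.sqrt (2 * wR φ u c S A) ≤ r) (hr' : 0 ≤ r')
    (hε : εt = Cx ^ 2 * B'' / Real.sqrt m * (4 * B' * Cx * τ * (p + q) + (r + r')))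
    (α : ℝ) (hα : α ∈ Set.Icc (0 : ℝ) 1) (v : Param d m) :
    -εt * ‖v‖ ^ 2 ≤ iteratedFDeriv ℝ 2 (wR φ u c S)
      (A + α • (V - A - η • (gradient (wR φ u c S) V - gradient (wR φ u c S) A))) ![v, v] := by
  have hB0' : 0 ≤ B' := (abs_nonneg _).trans (hB' 0)
  have hB0'' : 0 ≤ B'' := (abs_nonneg _).trans (hB'' 0)
  rw [iter_two hφ hφ']
  set D := V - A - η • (gradient (wR φ u c S) V - gradient (wR φ u c S) A) with hD
  refine le_trans ?_ (wDD_lower hB'' hu S c hc hx _ v)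
  have hVA : ‖V - A‖ ≤ Real.sqrt 2 * τ * (p + q) := by
    have e : V - A = (V - W0) - (A - W0) := by abel
    rw [e]; refine (norm_sub_le _ _).trans ?_; linarith
  have hDn : ‖D‖ ≤ 3 / 2 * ‖V - A‖ := by
    refine (norm_sub_le _ _).trans ?_
    rw [norm_smul, Real.norm_eq_abs, abs_of_pos hη0, grad_eq hφ, grad_eq hφ, ← map_sub,
      LinearIsometryEquiv.norm_map]
    have h1 := mul_le_mul_of_nonneg_left (wD_lip hφ hφ' hρ V A) hη0.le
    have h2 := mul_le_mul_of_nonneg_right hη (norm_nonneg (V - A))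
    linarith
  have hs2 : Real.sqrt 2 ≤ 2 := by
    rw [Real.sqrt_le_left (by norm_num)]; norm_num
  have hpq : 0 ≤ τ * (p + q) := by positivity
  have hD4 : ‖D‖ ≤ 4 * (τ * (p + q)) := by
    have := mul_le_mul_of_nonneg_right hs2 hpq
    linarith
  have hαD : ‖A + α • D - A‖ ≤ 4 * (τ * (p + q)) := by
    rw [add_sub_cancel_left, norm_smul, Real.norm_eq_abs, abs_of_nonneg hα.1]
    exact (mul_le_of_le_one_left (norm_nonneg _) hα.2).trans hD4
  have hres : ∑ j, c j * |nnet φ u (A + α • D) (S j).1 - (S j).2| ≤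
      4 * B' * Cx * τ * (p + q) + (r + r') := by
    calc _ ≤ ∑ j, (c j * (B' * Cx * (4 * (τ * (p + q)))) +
          c j * |nnet φ u A (S j).1 - (S j).2|) := by
          refine Finset.sum_le_sum fun j _ => ?_
          rw [← mul_add]
          refine mul_le_mul_of_nonneg_left ?_ (hc j)
          refine (abs_sub_le _ (nnet φ u A (S j).1) _).trans ?_
          gcongr
          refine (nnet_lip hm hφ hB' hu _ (hx j) _ _).trans ?_
          gcongr
      _ ≤ 1 * (B' * Cx * (4 * (τ * (p + q)))) + r := by
          rw [Finset.sum_add_distrib, ← Finset.sum_mul]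
          gcongr
          exact (resid hc hc1 A).trans hr
      _ ≤ _ := by linarith
  rw [hε]
  gcongr
end Aux

/-- curvature along the stability interpolation (Lemma 8 of the paper),
expressed through the Hessian quadratic form. -/
theorem statement8 {d m n : ℕ} (hm : 1 ≤ m) (hn : 1 ≤ n)
    (φ : ℝ → ℝ) (Bφ Bφ' Bφ'' : ℝ)
    (hφ : Differentiable ℝ φ) (hφ' : Differentiable ℝ (deriv φ))
    (hBφ : ∀ s : ℝ, |φ s| ≤ Bφ) (hBφ' : ∀ s : ℝ, |deriv φ s| ≤ Bφ')
    (hBφ'' : ∀ s : ℝ, |deriv (deriv φ) s| ≤ Bφ'')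
    (u : Fin m → ℝ) (hu : ∀ k, u k = 1 / Real.sqrt m ∨ u k = -(1 / Real.sqrt m))
    (Cx Cy : ℝ) (hCx : 0 < Cx) (hCy : 0 < Cy)
    (S : Fin n → Input d × ℝ) (i : Fin n) (ztil : Input d × ℝ)
    (hx : ∀ j, ‖(S j).1‖ ≤ Cx) (hy : ∀ j, |(S j).2| ≤ Cy)
    (hxt : ‖ztil.1‖ ≤ Cx) (hyt : |ztil.2| ≤ Cy)
    (W0 : Param d m) (η : ℝ) (hη0 : 0 < η)
    (ρ : ℝ) (hρ : ρ = Cx ^ 2 * (Bφ' ^ 2 + Bφ'' * Bφ + Bφ'' * Cy / Real.sqrt m))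
    (hη : η ≤ 1 / (2 * ρ))
    (s : ℕ)
    (εt : ℝ) (hεt : εt = Cx ^ 2 * Bφ'' / Real.sqrt m
        * (4 * Bφ' * Cx * Real.sqrt (η * s)
              * (Real.sqrt (empRisk φ u S W0)
                  + Real.sqrt (empRisk φ u (Function.update S i ztil) W0))
            + Real.sqrt (2 * empRisk φ u (Function.update S i ztil) W0)
            + Real.sqrt (2 * empRisk φ u S W0))) :
    ∀ α ∈ Set.Icc (0 : ℝ) 1, ∀ v : Param d m,
      -εt * ‖v‖ ^ 2
        ≤ iteratedFDeriv ℝ 2 (looRisk φ u S i)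
            (gdIter η (empRisk φ u (Function.update S i ztil)) W0 s
              + α • (gdIter η (empRisk φ u S) W0 s
                  - gdIter η (empRisk φ u (Function.update S i ztil)) W0 s
                  - η • (gradient (looRisk φ u S i) (gdIter η (empRisk φ u S) W0 s)
                      - gradient (looRisk φ u S i)
                          (gdIter η (empRisk φ u (Function.update S i ztil)) W0 s))))
            ![v, v]
      ∧ -εt * ‖v‖ ^ 2
        ≤ iteratedFDeriv ℝ 2 (looRisk φ u S i)
            (gdIter η (empRisk φ u S) W0 s
              + α • (gdIter η (empRisk φ u (Function.update S i ztil)) W0 s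
                  - gdIter η (empRisk φ u S) W0 s
                  - η • (gradient (looRisk φ u S i)
                          (gdIter η (empRisk φ u (Function.update S i ztil)) W0 s)
                      - gradient (looRisk φ u S i) (gdIter η (empRisk φ u S) W0 s))))
            ![v, v] := by
  have hρ0 : 0 < ρ := by
    by_contra hneg
    have : 1 / (2 * ρ) ≤ 0 := one_div_nonpos.2 (by linarith)
    linarith
  have hηρ : η * ρ ≤ 1 / 2 := by
    rw [le_div_iff₀ (by positivity)] at hη
    linarith
  have hn0 : (0 : ℝ) < n := by exact_mod_cast hn
  set S' := Function.update S i ztil with hS'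
  have hx' : ∀ j, ‖(S' j).1‖ ≤ Cx := fun j => by
    by_cases h : j = i
    · subst h; simpa [hS'] using hxt
    · simpa [hS', h] using hx j
  have hy' : ∀ j, |(S' j).2| ≤ Cy := fun j => by
    by_cases h : j = i
    · subst h; simpa [hS'] using hyt
    · simpa [hS', h] using hy j
  simp only [Aux.emp_eq, Aux.loo_eq] at hεt ⊢
  set c : Fin n → ℝ := fun _ => 1 / (n : ℝ) with hcdef
  set c' : Fin n → ℝ := fun j => if j = i then 0 else 1 / (n : ℝ) with hcdef'
  have hc : ∀ j, 0 ≤ c j := fun j => by simp only [hcdef]; positivity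
  have hc' : ∀ j, 0 ≤ c' j := fun j => by simp only [hcdef']; split_ifs <;> positivity
  have hcc : ∀ j, c' j ≤ c j := fun j => by
    simp only [hcdef, hcdef']; split_ifs
    · positivity
    · exact le_rfl
  have hc1 : ∑ j, c j ≤ 1 := by
    simp only [hcdef, Finset.sum_const, Finset.card_univ, Fintype.card_fin, nsmul_eq_mul]
    exact le_of_eq (mul_one_div_cancel hn0.ne')
  have hc1' : ∑ j, c' j ≤ 1 := (Finset.sum_le_sum fun j _ => hcc j).trans hc1
  have hH := Aux.wDD_bound hm hBφ hBφ' hBφ'' hu S c hc hc1 hx hy hρ0.le hρ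
  have hH' := Aux.wDD_bound hm hBφ hBφ' hBφ'' hu S' c hc hc1 hx' hy' hρ0.le hρ
  have hHl := Aux.wDD_bound hm hBφ hBφ' hBφ'' hu S c' hc' hc1' hx hy hρ0.le hρ
  obtain ⟨g1, g2⟩ := Aux.gd_bounds hφ hφ' hc hH hη0 hηρ W0 s
  obtain ⟨g1', g2'⟩ := Aux.gd_bounds hφ hφ' hc hH' hη0 hηρ W0 s
  have sq0 : ∀ W : Param d m, ∀ z, 0 ≤ sqLoss φ u W z := fun W z => by
    unfold sqLoss; positivity
  have l1 : ∀ W, Aux.wR φ u c' S W ≤ Aux.wR φ u c S W := fun W =>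
    Finset.sum_le_sum fun j _ => mul_le_mul_of_nonneg_right (hcc j) (sq0 _ _)
  have l2 : ∀ W, Aux.wR φ u c' S W ≤ Aux.wR φ u c S' W := fun W =>
    Finset.sum_le_sum fun j _ => by
      by_cases h : j = i
      · have : c' j = 0 := by simp [hcdef', h]
        rw [this, zero_mul]
        exact mul_nonneg (hc j) (sq0 _ _)
      · have : S' j = S j := by simp [hS', h]
        rw [this]
        exact mul_le_mul_of_nonneg_right (hcc j) (sq0 _ _)
  intro α hα v
  constructor
  · refine Aux.core hm hφ hφ' hBφ' hBφ'' hu hCx S c' hc' hc1' hx hHl hη0 hηρ _ _ W0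
      (Real.sqrt_nonneg _) (Real.sqrt_nonneg _) (Real.sqrt_nonneg _) g2' g2
      (r := Real.sqrt (2 * Aux.wR φ u c S' W0)) (r' := Real.sqrt (2 * Aux.wR φ u c S W0))
      ?_ (Real.sqrt_nonneg _) ?_ α hα v
    · exact Real.sqrt_le_sqrt (by linarith [l2 (gdIter η (Aux.wR φ u c S') W0 s)])
    · rw [hεt]; ring
  · refine Aux.core hm hφ hφ' hBφ' hBφ'' hu hCx S c' hc' hc1' hx hHl hη0 hηρ _ _ W0
      (Real.sqrt_nonneg _) (Real.sqrt_nonneg _) (Real.sqrt_nonneg _) g2 g2'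
      (r := Real.sqrt (2 * Aux.wR φ u c S W0)) (r' := Real.sqrt (2 * Aux.wR φ u c S' W0))
      ?_ (Real.sqrt_nonneg _) ?_ α hα v
    · exact Real.sqrt_le_sqrt (by linarith [l1 (gdIter η (Aux.wR φ u c S) W0 s)])
    · rw [hεt]; ring
end

section
/- (Concentration of the empirical NTK gram matrix) Let the columns W_{0,1},…,W_{0,m} of W_0 be i.i.d. samples from a probability distribution on ℝ^d, let x_1,…,x_n ∈ ℝ^d be fixed with ‖x_i‖₂ ≤ C_x, define K̂_{ij} = (1/(nm)) Σ_{k=1}^m φ'(⟨W_{0,k}, x_i⟩) φ'(⟨W_{0,k}, x_j⟩) ⟨x_i, x_j⟩ and K = E_{W_0}[K̂]. Then for any δ ∈ (0,1), with probability at least 1 − δ over W_0, ‖K̂ − K‖_F ≤ 2 B_{φ'}² C_x² √(ln(2n²/δ)/(2m)). -/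
open MeasureTheory Finset
open scoped BigOperators

theorem hoeff_aux {E : Type*} [MeasurableSpace E] {m : ℕ} (ν : Measure E) [IsProbabilityMeasure ν]
    (g : E → ℝ) (hg : Measurable g) (M : ℝ) (hM : ∀ w, |g w| ≤ M) (ε : ℝ) (hε : 0 ≤ ε) :
    (Measure.pi fun _ : Fin m => ν).real
      {W | ε ≤ |∑ k, g (W k) - ∫ W, ∑ k, g (W k) ∂(Measure.pi fun _ : Fin m => ν)|}
      ≤ 2 * Real.exp (-ε ^ 2 / (2 * (m * M ^ 2))) := by
  set μ := (Measure.pi fun _ : Fin m => ν) with hμ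
  have hmeas : ∀ k : Fin m, Measurable (fun W : Fin m → E => g (W k)) :=
    fun k => hg.comp (measurable_pi_apply k)
  have hIcc : ∀ (k : Fin m) (W : Fin m → E), g (W k) ∈ Set.Icc (-M) M :=
    fun k W => abs_le.1 (hM _)
  have hint : ∀ k : Fin m, Integrable (fun W : Fin m → E => g (W k)) μ := fun k =>
    Integrable.of_mem_Icc (-M) M (hmeas k).aemeasurable (ae_of_all _ (hIcc k))
  have hI : ∫ W, ∑ k, g (W k) ∂μ = ∑ k, ∫ W, g (W k) ∂μ :=
    integral_finsetSum _ fun k _ => hint k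
  have hind : ProbabilityTheory.iIndepFun
      (fun (k : Fin m) (W : Fin m → E) => g (W k) - ∫ W, g (W k) ∂μ) μ :=
    ProbabilityTheory.iIndepFun_pi (μ := fun _ : Fin m => ν)
      (X := fun k w => g w - ∫ W, g (W k) ∂μ) fun k => (hg.sub_const _).aemeasurable
  have hsub := ProbabilityTheory.HasSubgaussianMGF.sum_of_iIndepFun hind (s := Finset.univ)
    (c := fun _ => (‖M - (-M)‖₊ / 2) ^ 2) fun k _ =>
      ProbabilityTheory.hasSubgaussianMGF_of_mem_Icc (hmeas k).aemeasurable
        (ae_of_all _ (hIcc k))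
  have hc : ((∑ _i : Fin m, (‖M - (-M)‖₊ / 2) ^ 2 : NNReal) : ℝ) = m * M ^ 2 := by
    simp only [sum_const, card_univ, Fintype.card_fin, nsmul_eq_mul]
    push_cast
    rw [div_pow, Real.norm_eq_abs, sq_abs]
    ring
  have h1 := hsub.measure_ge_le hε
  have h2 := hsub.neg.measure_ge_le hε
  rw [hc] at h1 h2
  have hss : {W : Fin m → E | ε ≤ |∑ k, g (W k) - ∫ W, ∑ k, g (W k) ∂μ|} ⊆
      {W | ε ≤ ∑ k, (g (W k) - ∫ W, g (W k) ∂μ)} ∪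
      {W | ε ≤ (-fun W : Fin m → E => ∑ k, (g (W k) - ∫ W, g (W k) ∂μ)) W} := by
    intro W hW
    simp only [Set.mem_ofPred_eq, Set.mem_union, Pi.neg_apply, sum_sub_distrib] at hW ⊢
    rw [hI] at hW
    exact le_abs.1 hW
  calc _ ≤ _ := measureReal_mono hss
    _ ≤ _ := measureReal_union_le _ _
    _ ≤ _ := by linarith

/-- concentration of the empirical NTK gram matrix around its expectation,
in Frobenius norm, with probability at least `1 − δ` over the i.i.d. columns of `W₀`. -/
theorem statement10 {d m n : ℕ} (hm : 1 ≤ m) (hn : 1 ≤ n)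
    (φ : ℝ → ℝ) (Bφ' Cx : ℝ)
    (hφ : Differentiable ℝ φ) (hBφ' : ∀ s : ℝ, |deriv φ s| ≤ Bφ')
    (x : Fin n → Input d) (hx : ∀ i, ‖x i‖ ≤ Cx)
    (ν : Measure (Input d)) [IsProbabilityMeasure ν]
    (Khat : (Fin m → Input d) → Matrix (Fin n) (Fin n) ℝ)
    (hKhat : ∀ W0 i j, Khat W0 i j
      = (1 / ((n : ℝ) * m)) * ∑ k : Fin m,
          deriv φ (∑ a : Fin d, W0 k a * x i a) * deriv φ (∑ a : Fin d, W0 k a * x j a)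
            * (∑ a : Fin d, x i a * x j a))
    (K : Matrix (Fin n) (Fin n) ℝ)
    (hK : ∀ i j, K i j = ∫ W0, Khat W0 i j ∂(Measure.pi fun _ : Fin m => ν))
    (δ : ℝ) (hδ : δ ∈ Set.Ioo (0 : ℝ) 1) :
    ENNReal.ofReal (1 - δ)
      ≤ (Measure.pi fun _ : Fin m => ν)
          {W0 | Real.sqrt (∑ i : Fin n, ∑ j : Fin n, (Khat W0 i j - K i j) ^ 2)
              ≤ 2 * Bφ' ^ 2 * Cx ^ 2 * Real.sqrt (Real.log (2 * (n : ℝ) ^ 2 / δ) / (2 * m))} := by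
  obtain ⟨hδ0, hδ1⟩ := hδ
  have hn' : (1 : ℝ) ≤ n := by exact_mod_cast hn
  have hm' : (1 : ℝ) ≤ m := by exact_mod_cast hm
  have hn0 : (0 : ℝ) < n := by linarith
  have hm0 : (0 : ℝ) < m := by linarith
  set μ := (Measure.pi fun _ : Fin m => ν) with hμ
  set L := Real.log (2 * (n : ℝ) ^ 2 / δ) with hL
  have harg : 1 ≤ 2 * (n : ℝ) ^ 2 / δ := by
    rw [le_div_iff₀ hδ0]; nlinarith
  have hL0 : 0 ≤ L := Real.log_nonneg harg
  have hexpL : Real.exp (-L) = δ / (2 * (n : ℝ) ^ 2) := by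
    rw [Real.exp_neg, hL, Real.exp_log (by linarith), inv_div]
  set M := Bφ' ^ 2 * Cx ^ 2 with hMdef
  have hM0 : 0 ≤ M := by positivity
  have hB0 : 0 ≤ Bφ' := (abs_nonneg _).trans (hBφ' 0)
  have hC0 : 0 ≤ Cx := (norm_nonneg _).trans (hx ⟨0, hn⟩)
  set S := Real.sqrt (L / (2 * m)) with hS
  have hS0 : 0 ≤ S := Real.sqrt_nonneg _
  have hS2 : S ^ 2 = L / (2 * m) := Real.sq_sqrt (by positivity)
  set g : Fin n → Fin n → Input d → ℝ := fun i j w =>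
    deriv φ (∑ a : Fin d, w a * x i a) * deriv φ (∑ a : Fin d, w a * x j a)
            * (∑ a : Fin d, x i a * x j a) with hgdef
  have hgm : ∀ i j, Measurable (g i j) := by
    intro i j
    have h : ∀ i, Measurable fun w : Input d => deriv φ (∑ a : Fin d, w a * x i a) := fun i =>
      (measurable_deriv φ).comp (by fun_prop)
    exact ((h i).mul (h j)).mul_const _
  have hgM : ∀ i j w, |g i j w| ≤ M := by
    intro i j w
    have hin : |∑ a : Fin d, x i a * x j a| ≤ Cx * Cx := by
      have h1 : ∑ a : Fin d, x i a * x j a = inner ℝ (x i) (x j) := by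
        simp [PiLp.inner_apply, mul_comm]
      rw [h1]
      exact (abs_real_inner_le_norm _ _).trans
        (mul_le_mul (hx i) (hx j) (norm_nonneg _) hC0)
    simp only [hgdef, abs_mul]
    calc _ ≤ (Bφ' * Bφ') * (Cx * Cx) := by
          gcongr
          · exact hBφ' _
          · exact hBφ' _
      _ = M := by rw [hMdef]; ring
  have hKd : ∀ W i j, Khat W i j - K i j
      = (1 / ((n : ℝ) * m)) * (∑ k, g i j (W k) - ∫ W, ∑ k, g i j (W k) ∂μ) := by
    intro W i j
    rw [hK, mul_sub, ← integral_const_mul, hKhat]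
    congr 2
    funext W
    exact hKhat W i j
  -- deterministic part
  have hdet : ∀ W : Fin m → Input d,
      (∀ i j, |∑ k, g i j (W k) - ∫ W, ∑ k, g i j (W k) ∂μ| ≤ m * (2 * M * S)) →
      Real.sqrt (∑ i : Fin n, ∑ j : Fin n, (Khat W i j - K i j) ^ 2)
        ≤ 2 * Bφ' ^ 2 * Cx ^ 2 * S := by
    intro W hW
    have hR : 2 * Bφ' ^ 2 * Cx ^ 2 * S = 2 * M * S := by rw [hMdef]; ring
    rw [hR]
    apply Real.sqrt_le_iff.2 ⟨by positivity, ?_⟩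
    have : ∀ i j, (Khat W i j - K i j) ^ 2 ≤ (2 * M * S / n) ^ 2 := by
      intro i j
      rw [hKd]
      apply sq_le_sq'
      · have := (abs_le.1 (hW i j)).1
        rw [div_mul_eq_mul_div, one_mul, le_div_iff₀ (by positivity)]
        calc _ = -(m * (2 * M * S)) := by field_simp
          _ ≤ _ := this
      · have := (abs_le.1 (hW i j)).2
        rw [div_mul_eq_mul_div, one_mul, div_le_iff₀ (by positivity)]
        calc _ ≤ _ := this
          _ = _ := by field_simp
    calc _ ≤ ∑ i : Fin n, ∑ j : Fin n, (2 * M * S / n) ^ 2 :=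
          sum_le_sum fun i _ => sum_le_sum fun j _ => this i j
      _ = _ := by
          simp only [sum_const, card_univ, Fintype.card_fin, nsmul_eq_mul]
          field_simp
  set G := {W0 | Real.sqrt (∑ i : Fin n, ∑ j : Fin n, (Khat W0 i j - K i j) ^ 2)
              ≤ 2 * Bφ' ^ 2 * Cx ^ 2 * S} with hG
  rcases hM0.eq_or_lt with hMz | hMpos
  · have hGu : G = Set.univ := by
      refine Set.eq_univ_of_forall fun W => hdet W fun i j => ?_
      have hz : ∀ w, g i j w = 0 := fun w => abs_nonpos_iff.1 ((hgM i j w).trans hMz.symm.le)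
      simp [hz, ← hMz]
    rw [hGu, measure_univ]
    exact ENNReal.ofReal_le_one.2 (by linarith)
  set D : Fin n → Fin n → Set (Fin m → Input d) := fun i j =>
    {W | m * (2 * M * S) ≤ |∑ k, g i j (W k) - ∫ W, ∑ k, g i j (W k) ∂μ|} with hD
  have hDb : ∀ i j, μ.real (D i j) ≤ δ / n ^ 2 := by
    intro i j
    refine (hoeff_aux ν (g i j) (hgm i j) M (hgM i j) (m * (2 * M * S)) (by positivity)).trans ?_
    have : -(m * (2 * M * S)) ^ 2 / (2 * (m * M ^ 2)) = -L := by
      rw [mul_pow, mul_pow, hS2]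
      field_simp
    rw [this, hexpL]
    apply le_of_eq
    field_simp
  have hbad : μ.real (⋃ i, ⋃ j, D i j) ≤ δ := by
    calc _ ≤ ∑ i, μ.real (⋃ j, D i j) := measureReal_iUnion_fintype_le _
      _ ≤ ∑ i : Fin n, ∑ j : Fin n, μ.real (D i j) :=
          sum_le_sum fun i _ => measureReal_iUnion_fintype_le _
      _ ≤ ∑ i : Fin n, ∑ j : Fin n, δ / (n : ℝ) ^ 2 :=
          sum_le_sum fun i _ => sum_le_sum fun j _ => hDb i j
      _ = δ := by
          simp only [sum_const, card_univ, Fintype.card_fin, nsmul_eq_mul]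
          field_simp
  have hcov : (Set.univ : Set (Fin m → Input d)) ⊆ G ∪ ⋃ i, ⋃ j, D i j := by
    intro W _
    by_cases h : W ∈ ⋃ i, ⋃ j, D i j
    · exact Or.inr h
    · left
      refine hdet W fun i j => ?_
      simp only [Set.mem_iUnion, not_exists] at h
      exact (not_le.1 (h i j)).le
  have h1 : (1 : ℝ) ≤ μ.real G + μ.real (⋃ i, ⋃ j, D i j) := by
    calc (1 : ℝ) = μ.real Set.univ := by simp
      _ ≤ _ := measureReal_mono hcov
      _ ≤ _ := measureReal_union_le _ _
  rw [← ofReal_measureReal (μ := μ) (s := G)]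
  exact ENNReal.ofReal_le_ofReal (by linarith)
end

section
/- (Explicit NTK relaxation of the regularised ERM oracle) Let Φ_0 ∈ ℝ^{dm×n} be the matrix whose i-th column is the gradient ∇_W f_W(x_i) evaluated at W_0 (that is, its k-th ℝ^d-block equals u_k φ'(⟨W_{0,k}, x_i⟩) x_i), let K̂ = (1/n)Φ_0ᵀΦ_0, let ŷ_0 = (f_{W_0}(x_1),…,f_{W_0}(x_n)) and y = (y_1,…,y_n). If K̂ is invertible and q = (y − ŷ_0)ᵀ (nK̂)^{-1} (y − ŷ_0), then: (i) the parameter W^{pinv} whose vectorisation is vec(W_0) + Φ_0 (nK̂)^{-1}(y − ŷ_0) satisfies Φ_0ᵀ(vec(W^{pinv}) − vec(W_0)) = y − ŷ_0 and ‖W^{pinv} − W_0‖_F² = q; and (ii) for every ηT > 0, min_{W ∈ ℝ^{d×m}} { L_S(W) + ‖W − W_0‖_F²/(ηT) } ≤ (B_{φ''}² C_x⁴/(4m)) q² + q/(ηT). -/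
open MeasureTheory Finset
open scoped BigOperators

lemma taylor_upper (φ : ℝ → ℝ) (B : ℝ) (hφ : Differentiable ℝ φ)
    (hφ' : Differentiable ℝ (deriv φ)) (hB : ∀ s : ℝ, |deriv (deriv φ) s| ≤ B) (a h : ℝ) :
    φ (a + h) - φ a - deriv φ a * h ≤ B / 2 * h ^ 2 := by
  have hlip : ∀ s, |deriv φ s - deriv φ a| ≤ B * |s - a| := by
    intro s
    have := Convex.norm_image_sub_le_of_norm_deriv_le (f := deriv φ) (C := B) (s := Set.univ)
      (x := a) (y := s) (fun x _ => hφ' x) (fun x _ => hB x) convex_univ (Set.mem_univ _)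
      (Set.mem_univ _)
    simpa [Real.norm_eq_abs] using this
  have hd : ∀ t : ℝ, HasDerivAt (fun t : ℝ => φ (a + t * h) - deriv φ a * (t * h)
      - B / 2 * (t * h) ^ 2) (deriv φ (a + t * h) * h - deriv φ a * h - B * (t * h) * h) t := by
    intro t
    have h1 : HasDerivAt (fun t : ℝ => t * h) h t := by
      simpa using (hasDerivAt_id t).mul_const h
    have h2 : HasDerivAt (fun t : ℝ => φ (a + t * h)) (deriv φ (a + t * h) * h) t :=
      (hφ (a + t * h)).hasDerivAt.comp t (h1.const_add a)
    have h3 := (h2.sub (h1.const_mul (deriv φ a))).sub ((h1.pow 2).const_mul (B / 2))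
    refine h3.congr_deriv ?_
    simp
    ring
  have hanti : AntitoneOn (fun t : ℝ => φ (a + t * h) - deriv φ a * (t * h)
      - B / 2 * (t * h) ^ 2) (Set.Icc 0 1) := by
    apply antitoneOn_of_deriv_nonpos (convex_Icc 0 1)
    · exact fun t _ => (hd t).continuousAt.continuousWithinAt
    · exact fun t _ => (hd t).differentiableAt.differentiableWithinAt
    · intro t ht
      rw [interior_Icc] at ht
      rw [(hd t).deriv]
      have h1 := hlip (a + t * h)
      have h2 : |(deriv φ (a + t * h) - deriv φ a) * h| ≤ B * (t * h) * h := by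
        rw [abs_mul]
        calc _ ≤ B * |a + t * h - a| * |h| := by gcongr
          _ = _ := by
            rw [add_sub_cancel_left, abs_mul, abs_of_pos ht.1]
            linear_combination (B * t) * abs_mul_abs_self h
      nlinarith [le_abs_self ((deriv φ (a + t * h) - deriv φ a) * h)]
  have := hanti (Set.left_mem_Icc.2 zero_le_one) (Set.right_mem_Icc.2 zero_le_one) zero_le_one
  simp at this
  linarith

lemma taylor_abs (φ : ℝ → ℝ) (B : ℝ) (hφ : Differentiable ℝ φ)
    (hφ' : Differentiable ℝ (deriv φ)) (hB : ∀ s : ℝ, |deriv (deriv φ) s| ≤ B) (a h : ℝ) :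
    |φ (a + h) - φ a - deriv φ a * h| ≤ B / 2 * h ^ 2 := by
  have h1 := taylor_upper φ B hφ hφ' hB a h
  have e : deriv (fun x => - φ x) = fun x => - deriv φ x := by
    funext x; simp
  have h2 := taylor_upper (fun x => - φ x) B hφ.neg (by rw [e]; exact hφ'.neg)
    (by intro s; rw [e]; simpa using hB s) a h
  rw [e] at h2
  rw [abs_le]; constructor <;> linarith

open Matrix in
/-- explicit NTK (pseudo-inverse) relaxation of the regularised ERM oracle. -/
theorem statement11 {d m n : ℕ} (hm : 1 ≤ m) (hn : 1 ≤ n)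
    (φ : ℝ → ℝ) (Bφ' Bφ'' Cx : ℝ)
    (hφ : Differentiable ℝ φ) (hφ' : Differentiable ℝ (deriv φ))
    (hBφ' : ∀ s : ℝ, |deriv φ s| ≤ Bφ') (hBφ'' : ∀ s : ℝ, |deriv (deriv φ) s| ≤ Bφ'')
    (u : Fin m → ℝ) (hu : ∀ k, u k = 1 / Real.sqrt m ∨ u k = -(1 / Real.sqrt m))
    (S : Fin n → Input d × ℝ) (hx : ∀ i, ‖(S i).1‖ ≤ Cx)
    (W0 : Param d m)
    (Φ0 : Matrix (Fin m × Fin d) (Fin n) ℝ)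
    (hΦ0 : ∀ (k : Fin m) (a : Fin d) (i : Fin n),
      Φ0 (k, a) i = u k * deriv φ (∑ b : Fin d, W0 (k, b) * (S i).1 b) * (S i).1 a)
    (Khat : Matrix (Fin n) (Fin n) ℝ) (hKhat : Khat = (1 / (n : ℝ)) • (Φ0ᵀ * Φ0))
    (hinv : IsUnit Khat.det)
    (y yhat0 : Fin n → ℝ)
    (hy : ∀ i, y i = (S i).2) (hyhat0 : ∀ i, yhat0 i = nnet φ u W0 (S i).1)
    (q : ℝ) (hq : q = (y - yhat0) ⬝ᵥ (((n : ℝ) • Khat)⁻¹ *ᵥ (y - yhat0)))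
    (Wpinv : Param d m)
    (hWpinv : ∀ p : Fin m × Fin d,
      Wpinv p = W0 p + (Φ0 *ᵥ (((n : ℝ) • Khat)⁻¹ *ᵥ (y - yhat0))) p)
    (ηT : ℝ) (hηT : 0 < ηT) :
    (Φ0ᵀ *ᵥ (fun p => Wpinv p - W0 p) = fun i => y i - yhat0 i)
    ∧ ‖Wpinv - W0‖ ^ 2 = q
    ∧ (⨅ W : Param d m, (empRisk φ u S W + ‖W - W0‖ ^ 2 / ηT))
        ≤ Bφ'' ^ 2 * Cx ^ 4 / (4 * m) * q ^ 2 + q / ηT := by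
  have hn0 : (n : ℝ) ≠ 0 := by positivity
  have hmpos : (0 : ℝ) < m := by exact_mod_cast hm
  have hnpos : (0 : ℝ) < n := by exact_mod_cast hn
  have hG : (n : ℝ) • Khat = Φ0ᵀ * Φ0 := by
    rw [hKhat, smul_smul, mul_one_div_cancel hn0, one_smul]
  have hGu : IsUnit (Φ0ᵀ * Φ0).det := by
    rw [← hG, det_smul]
    exact (IsUnit.mk0 _ (pow_ne_zero _ hn0)).mul hinv
  rw [hG] at hq hWpinv
  set r := y - yhat0 with hr
  set v := (Φ0ᵀ * Φ0)⁻¹ *ᵥ r with hv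
  have hGv : (Φ0ᵀ * Φ0) *ᵥ v = r := by
    rw [hv, mulVec_mulVec, mul_nonsing_inv _ hGu, one_mulVec]
  have hdiff : (fun p => Wpinv p - W0 p) = Φ0 *ᵥ v := by
    funext p; rw [hWpinv p]; ring
  have hi : Φ0ᵀ *ᵥ (fun p => Wpinv p - W0 p) = fun i => y i - yhat0 i := by
    rw [hdiff, mulVec_mulVec, hGv]; rfl
  have hnorm : ‖Wpinv - W0‖ ^ 2 = q := by
    rw [EuclideanSpace.real_norm_sq_eq]
    have : ∑ p, (Wpinv - W0) p ^ 2 = (Φ0 *ᵥ v) ⬝ᵥ (Φ0 *ᵥ v) := by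
      rw [← hdiff]
      simp [dotProduct, sq]
    rw [this, hq, dotProduct_mulVec, vecMul_mulVec, ← mulVec_transpose, transpose_mul,
      transpose_transpose, hGv]
  refine ⟨hi, hnorm, ?_⟩
  have hB0 : 0 ≤ Bφ'' := (abs_nonneg _).trans (hBφ'' 0)
  have hsum : ∑ k, ∑ j, (Wpinv (k, j) - W0 (k, j)) ^ 2 = q := by
    rw [← hnorm, EuclideanSpace.real_norm_sq_eq, Fintype.sum_prod_type]
    simp
  have hukabs : ∀ k, |u k| = 1 / Real.sqrt m := by
    intro k
    have : (0:ℝ) ≤ 1 / Real.sqrt m := by positivity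
    rcases hu k with h | h <;> rw [h]
    · exact abs_of_nonneg this
    · rw [abs_neg]; exact abs_of_nonneg this
  have hres : ∀ i, |nnet φ u Wpinv (S i).1 - (S i).2|
      ≤ 1 / Real.sqrt m * (Bφ'' / 2 * (Cx ^ 2 * q)) := by
    intro i
    have hxi : ∑ j, (S i).1 j ^ 2 ≤ Cx ^ 2 := by
      rw [← EuclideanSpace.real_norm_sq_eq]
      exact pow_le_pow_left₀ (norm_nonneg _) (hx i) 2
    let a : Fin m → ℝ := fun k => ∑ j, W0 (k, j) * (S i).1 j
    let h : Fin m → ℝ := fun k => ∑ j, (Wpinv (k, j) - W0 (k, j)) * (S i).1 j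
    have hah : ∀ k, ∑ j, Wpinv (k, j) * (S i).1 j = a k + h k := by
      intro k
      simp only [a, h, ← Finset.sum_add_distrib]
      exact Finset.sum_congr rfl fun j _ => by ring
    have hlin : ∑ k, u k * (deriv φ (a k) * h k) = (S i).2 - nnet φ u W0 (S i).1 := by
      have := congrFun hi i
      rw [hy, hyhat0] at this
      rw [← this]
      simp only [mulVec, dotProduct, transpose_apply, Fintype.sum_prod_type, hΦ0, a, h,
        Finset.mul_sum]
      refine Finset.sum_congr rfl fun k _ => Finset.sum_congr rfl fun j _ => by ring
    have heq : nnet φ u Wpinv (S i).1 - (S i).2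
        = ∑ k, u k * (φ (a k + h k) - φ (a k) - deriv φ (a k) * h k) := by
      simp only [mul_sub, Finset.sum_sub_distrib, hlin]
      simp only [nnet, hah]
      simp only [a]
      ring
    rw [heq]
    calc _ ≤ ∑ k, |u k * (φ (a k + h k) - φ (a k) - deriv φ (a k) * h k)| :=
          Finset.abs_sum_le_sum_abs _ _
      _ ≤ ∑ k, 1 / Real.sqrt m *
            (Bφ'' / 2 * (Cx ^ 2 * ∑ j, (Wpinv (k, j) - W0 (k, j)) ^ 2)) := by
          refine Finset.sum_le_sum fun k _ => ?_
          rw [abs_mul, hukabs]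
          have h1 := taylor_abs φ Bφ'' hφ hφ' hBφ'' (a k) (h k)
          have h2 : h k ^ 2 ≤ Cx ^ 2 * ∑ j, (Wpinv (k, j) - W0 (k, j)) ^ 2 := by
            have h3 := Finset.sum_mul_sq_le_sq_mul_sq Finset.univ
              (fun j => Wpinv (k, j) - W0 (k, j)) (fun j => (S i).1 j)
            refine h3.trans ?_
            rw [mul_comm]
            exact mul_le_mul_of_nonneg_right hxi (Finset.sum_nonneg fun j _ => sq_nonneg _)
          refine mul_le_mul_of_nonneg_left (h1.trans ?_) (by positivity)
          exact mul_le_mul_of_nonneg_left h2 (by positivity)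
      _ = _ := by simp only [← Finset.mul_sum, hsum]
  have hloss : ∀ i, sqLoss φ u Wpinv (S i) ≤ Bφ'' ^ 2 * Cx ^ 4 / (4 * m) * q ^ 2 := by
    intro i
    have h1 := pow_le_pow_left₀ (abs_nonneg _) (hres i) 2
    rw [sq_abs] at h1
    have h2 : (1 / Real.sqrt m * (Bφ'' / 2 * (Cx ^ 2 * q))) ^ 2
        = Bφ'' ^ 2 * Cx ^ 4 / (4 * m) * q ^ 2 := by
      rw [mul_pow, div_pow, Real.sq_sqrt hmpos.le]
      field_simp
      ring
    rw [h2] at h1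
    unfold sqLoss
    linarith [sq_nonneg (nnet φ u Wpinv (S i).1 - (S i).2)]
  have hemp : empRisk φ u S Wpinv ≤ Bφ'' ^ 2 * Cx ^ 4 / (4 * m) * q ^ 2 := by
    unfold empRisk
    rw [div_le_iff₀ hnpos]
    refine (Finset.sum_le_sum fun i _ => hloss i).trans ?_
    simp [mul_comm]
  have hbdd : BddBelow (Set.range fun W : Param d m =>
      empRisk φ u S W + ‖W - W0‖ ^ 2 / ηT) := by
    refine ⟨0, ?_⟩
    rintro _ ⟨W, rfl⟩
    have : 0 ≤ empRisk φ u S W :=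
      div_nonneg (Finset.sum_nonneg fun i _ => by unfold sqLoss; positivity) hnpos.le
    show 0 ≤ empRisk φ u S W + ‖W - W0‖ ^ 2 / ηT
    positivity
  refine (ciInf_le hbdd Wpinv).trans ?_
  rw [hnorm]
  linarith
end
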